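/- arXiv:2307.00317 — 3 statements merged into one kernel-verified Lean document; each statement's English description precedes it below -/
import Mathlib

section
/- Let n ≥ 2k ≥ 2 and let ℓ ≤ n-2k+1. Given subsets V_1, ..., V_ℓ of [n], each of size at least 2, there exists a stable k-subset S of [n] such that |S ∩ V_i| ≤ |V_i|/2 for every i ∈ [ℓ]. -/
/-- A subset `S` of `[n] = {1,...,n}` is stable if it contains no two cyclically
consecutive elements. -/
def IsStable (n : ℕ) (S : Finset ℕ) : Prop :=
  (∀ i ∈ Finset.Icc 1 n, ¬(i ∈ S ∧ i + 1 ∈ S)) ∧ ¬(n ∈ S ∧ 1 ∈ S)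

namespace Tuck

/-- Sign vectors. -/
abbrev P := ℕ → SignType

def le (x y : P) : Prop := ∀ i, x i = 0 ∨ x i = y i

/-- faces of a list -/
def bd {A : Type} : List A → List (List A)
  | [] => []
  | a :: l => l :: (bd l).map (List.cons a)

/-- evaluation of a function on a formal sum of lists -/
def E {A : Type} (f : List A → ZMod 2) (L : List (List A)) : ZMod 2 := (L.map f).sum

section
variable {A : Type}

lemma E_nil (f : List A → ZMod 2) : E f [] = 0 := rfl
lemma E_cons (f : List A → ZMod 2) (l L) : E f (l :: L) = f l + E f L := by simp [E]
lemma E_append (f : List A → ZMod 2) (L M) : E f (L ++ M) = E f L + E f M := by simp [E]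
lemma E_map {B : Type} (f : List A → ZMod 2) (g : List B → List A) (L) :
    E f (L.map g) = E (fun l => f (g l)) L := by simp [E, Function.comp_def]
lemma E_flatMap {B : Type} (f : List A → ZMod 2) (g : List B → List (List A)) (L) :
    E f (L.flatMap g) = E (fun l => E f (g l)) L := by
  induction L with
  | nil => rfl
  | cons a L ih => rw [List.flatMap_cons, E_append, ih, E_cons]
lemma E_add (f g : List A → ZMod 2) (L) : E (fun l => f l + g l) L = E f L + E g L := by
  simp [E, List.sum_map_add]
lemma E_congr {f g : List A → ZMod 2} {L} (h : ∀ l ∈ L, f l = g l) : E f L = E g L := by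
  unfold E; rw [List.map_congr_left h]
lemma E_zero {f : List A → ZMod 2} {L} (h : ∀ l ∈ L, f l = 0) : E f L = 0 := by
  rw [E_congr h]; simp [E]

lemma bd_map {B : Type} (g : A → B) (l : List A) : bd (l.map g) = (bd l).map (List.map g) := by
  induction l with
  | nil => rfl
  | cons a l ih => simp [bd, ih, Function.comp_def]

lemma bd_sublist (l : List A) : ∀ m ∈ bd l, m.Sublist l := by
  induction l with
  | nil => simp [bd]
  | cons a l ih =>
    intro m hm
    simp only [bd, List.mem_cons, List.mem_map] at hm
    rcases hm with rfl | ⟨m', hm', rfl⟩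
    · exact List.sublist_cons_self _ _
    · exact (ih m' hm').cons_cons a

lemma E_bd_perm {l m : List A} (h : l.Perm m) : ∀ (f : List A → ZMod 2),
    (∀ a b, a.Perm b → f a = f b) → E f (bd l) = E f (bd m) := by
  induction h with
  | nil => intros; rfl
  | cons a h ih =>
    intro f hf
    simp only [bd, E_cons, E_map]
    rw [hf _ _ h, ih (fun l => f (a :: l)) (fun _ _ hab => hf _ _ (hab.cons a))]
  | swap a b l =>
    intro f hf
    simp only [bd, E_cons, E_map, List.map_cons]
    have : E (fun l => f (b :: a :: l)) (bd l) = E (fun l => f (a :: b :: l)) (bd l) :=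
      E_congr (fun l _ => hf _ _ (List.Perm.swap _ _ _))
    rw [this]; ring
  | trans _ _ ih1 ih2 => intro f hf; rw [ih1 f hf, ih2 f hf]
end

/-- alternating indicator -/
def beta : Bool → List ℕ → ZMod 2
  | _, [] => 1
  | s, a :: l => if decide (a % 2 = 1) = s then beta (!s) l else 0

lemma z2 (a : ZMod 2) : a + a = 0 := CharTwo.add_self_eq_zero a

lemma beta_bd (l : List ℕ) : ∀ s, E (beta s) (bd l) = beta s l + beta (!s) l := by
  induction l with
  | nil => intro s; simp only [bd, E_nil, beta, z2]
  | cons a l ih =>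
    intro s
    simp only [bd, E_cons, E_map, beta]
    by_cases h : decide (a % 2 = 1) = s
    · have h' : ¬ decide (a % 2 = 1) = !s := by rw [h]; cases s <;> simp
      simp only [h, if_true, ih, Bool.not_not]
      have : ¬ s = !s := by cases s <;> simp
      rw [if_neg this, add_zero]
      linear_combination z2 (beta s l)
    · have h' : decide (a % 2 = 1) = !s := by
        revert h; cases s <;> cases decide (a % 2 = 1) <;> simp
      simp only [h, h', if_true, if_false, Bool.not_not]
      have : ¬ (!s) = s := by cases s <;> simp
      simp only [if_neg this]
      rw [E_zero (fun _ _ => rfl)]; ring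

def srt (l : List ℕ) : List ℕ := l.insertionSort (· ≤ ·)

lemma srt_perm (l) : (srt l).Perm l := List.perm_insertionSort _ _
lemma srt_sorted (l) : (srt l).Pairwise (· ≤ ·) := List.pairwise_insertionSort _ _
lemma srt_eq {l m : List ℕ} (h : l.Perm m) (hm : m.Pairwise (· ≤ ·)) : srt l = m :=
  ((srt_perm l).trans h).eq_of_pairwise (fun _ _ _ _ h1 h2 => le_antisymm h1 h2) (srt_sorted l) hm

lemma beta_srt_bd (s) (l : List ℕ) :
    E (fun l => beta s (srt l)) (bd l) = beta s (srt l) + beta (!s) (srt l) := by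
  rw [← beta_bd, E_bd_perm (srt_perm l).symm]
  · refine E_congr (fun m hm => ?_)
    rw [srt_eq (List.Perm.refl m) ((srt_sorted l).sublist (bd_sublist _ m hm))]
  · intro a b hab
    rw [srt_eq (hab.trans (srt_perm b).symm) (srt_sorted b)]

def flip (a : ℕ) : ℕ := if a % 2 = 1 then a - 1 else a + 1

lemma flip_odd (a : ℕ) : decide (flip a % 2 = 1) = !decide (a % 2 = 1) := by
  unfold flip
  by_cases h : a % 2 = 1
  · have : ¬ (a - 1) % 2 = 1 := by omega
    simp [h, this]
  · have : (a + 1) % 2 = 1 := by omega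
    simp [h, this]

lemma beta_flip (l : List ℕ) : ∀ s, beta s (l.map flip) = beta (!s) l := by
  induction l with
  | nil => intro s; rfl
  | cons a l ih =>
    intro s
    simp only [List.map_cons, beta, flip_odd, ih]
    cases s <;> cases decide (a % 2 = 1) <;> simp

def NC (l : List ℕ) : Prop := ∀ a ∈ l, ∀ b ∈ l, a / 2 = b / 2 → a = b

lemma beta_srt_flip (s) (l : List ℕ) (h : NC l) :
    beta s (srt (l.map flip)) = beta (!s) (srt l) := by
  rw [← beta_flip]
  congr 1
  apply srt_eq
  · exact ((srt_perm l).symm).map _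
  · rw [List.pairwise_map]
    refine List.Pairwise.imp_of_mem ?_ (srt_sorted l)
    intro a b ha hb hab
    have := h a ((srt_perm l).mem_iff.1 ha) b ((srt_perm l).mem_iff.1 hb)
    unfold flip
    split_ifs <;> omega

lemma beta_len (N : ℕ) (l : List ℕ) : ∀ s t, beta s l ≠ 0 → l.Pairwise (· ≤ ·) → NC l →
    (∀ a ∈ l, t ≤ a / 2 ∧ a / 2 < N) → t ≤ N → l.length ≤ N - t := by
  induction l with
  | nil => intros; simp
  | cons a l ih =>
    intro s t hb hs hn hl ht
    have ha := hl a (by simp)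
    have hp : decide (a % 2 = 1) = s := by
      by_contra h; simp [beta, h] at hb
    have hb' : beta (!s) l ≠ 0 := by simpa [beta, hp] using hb
    have := ih (!s) (a / 2 + 1) hb' (List.pairwise_cons.1 hs).2
      (fun x hx y hy => hn x (by simp [hx]) y (by simp [hy])) ?_ (by omega)
    · simp only [List.length_cons]; omega
    · intro c hc
      refine ⟨?_, (hl c (by simp [hc])).2⟩
      cases l with
      | nil => simp at hc
      | cons b l' =>
        have hq : decide (b % 2 = 1) = !s := by
          by_contra h; simp [beta, h] at hb'
        have hab : a ≠ b := by rintro rfl; rw [hp] at hq; cases s <;> simp at hq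
        have h1 : a ≤ b := (List.pairwise_cons.1 hs).1 b (by simp)
        have h2 := hn a (by simp) b (by simp)
        have h3 : b ≤ c := by
          rcases List.mem_cons.1 hc with rfl | h
          · exact le_rfl
          · exact (List.pairwise_cons.1 (List.pairwise_cons.1 hs).2).1 c h
        have : a / 2 ≠ b / 2 := fun h => hab (h2 h)
        omega

/-! chains -/

def up (k : ℕ) (x : P) : P := Function.update x k 1

def G (k : ℕ) : List P → List (List P)
  | [] => []
  | x :: l => (x :: up k x :: l.map (up k)) :: (G k l).map (List.cons x)

def D (k : ℕ) (l : List P) : List (List P) := (up k 0 :: l.map (up k)) :: G k l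

lemma G_bd (k : ℕ) (l : List P) : ∀ f : List P → ZMod 2,
    E (fun m => E f (bd m)) (G k l) = f l + f (l.map (up k)) + E (fun m => E f (G k m)) (bd l) := by
  induction l with
  | nil => intro f; simp only [bd, G, E_nil, List.map_nil, z2, add_zero]
  | cons x l ih =>
    intro f
    simp only [bd, G, E_cons, E_map, List.map_cons, E_add, ih (fun m => f (x :: m)), bd_map,
      add_zero]
    have : E (fun m => f m) (G k l) = E f (G k l) := rfl
    rw [this]
    linear_combination z2 (f (x :: l.map (up k)))

lemma D_bd (k : ℕ) (l : List P) (f : List P → ZMod 2) :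
    E (fun m => E f (bd m)) (D k l) = f l + E (fun m => E f (D k m)) (bd l) := by
  simp only [D, E_cons, bd, E_map, bd_map, E_add, G_bd]
  linear_combination z2 (f (l.map (up k)))

def neg (l : List P) : List P := l.map (fun x => -x)

def Z : ℕ → List (List P)
  | 0 => [[]]
  | k + 1 => (Z k).flatMap (D k) ++ ((Z k).flatMap (D k)).map neg

lemma neg_neg' (l : List P) : neg (neg l) = l := by simp [neg, Function.comp_def]

lemma Z_neg (k : ℕ) (f : List P → ZMod 2) : E (fun l => f (neg l)) (Z k) = E f (Z k) := by
  cases k with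
  | zero => simp [Z, E, neg]
  | succ k => simp only [Z, E_append, E_map, neg_neg']; rw [add_comm]

lemma Z_bd (k : ℕ) : ∀ (f : List P → ZMod 2), E (fun l => E f (bd l)) (Z k) = 0 := by
  induction k with
  | zero => intro f; simp [Z, E, bd]
  | succ k ih =>
    intro f
    have h : ∀ l, E f (bd (neg l)) = E (fun m => f (neg m)) (bd l) := by
      intro l
      have : bd (neg l) = (bd l).map neg := bd_map _ _
      rw [this, E_map]
    simp only [Z, E_append, E_map, E_flatMap, h, D_bd, E_add, ih, Z_neg]
    rw [add_zero, z2]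

structure Valid (k : ℕ) (l : List P) : Prop where
  len : l.length = k
  pw : l.Pairwise le
  nz : ∀ x ∈ l, ∃ i < k, x i ≠ 0
  supp : ∀ x ∈ l, ∀ i, k ≤ i → x i = 0

lemma le_up {k : ℕ} {x y : P} (h : le x y) (hx : x k = 0) : le x (up k y) := by
  intro i
  by_cases hi : i = k
  · subst hi; left; exact hx
  · simpa [up, hi] using h i

lemma up_le_up {k : ℕ} {x y : P} (h : le x y) : le (up k x) (up k y) := by
  intro i
  by_cases hi : i = k
  · subst hi; right; simp [up]
  · simpa [up, hi] using h i

lemma le_refl' (x : P) : le x x := fun _ => Or.inr rfl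

lemma G_spec (k : ℕ) (l : List P) (hp : l.Pairwise le) (hs : ∀ x ∈ l, x k = 0) :
    ∀ m ∈ G k l, m.length = l.length + 1 ∧ m.Pairwise le ∧
      ∀ y ∈ m, y ∈ l ∨ ∃ x ∈ l, y = up k x := by
  induction l with
  | nil => simp [G]
  | cons x l ih =>
    rw [List.pairwise_cons] at hp
    have hx := hs x (by simp)
    intro m hm
    simp only [G, List.mem_cons, List.mem_map] at hm
    rcases hm with rfl | ⟨m', hm', rfl⟩
    · refine ⟨by simp, ?_, ?_⟩
      · simp only [List.pairwise_cons, List.mem_cons, List.mem_map, List.pairwise_map]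
        refine ⟨?_, ?_, hp.2.imp up_le_up⟩
        · rintro a (rfl | ⟨b, hb, rfl⟩)
          · exact le_up (le_refl' _) hx
          · exact le_up (hp.1 b hb) hx
        · rintro a ⟨b, hb, rfl⟩
          exact up_le_up (hp.1 b hb)
      · intro y hy
        simp only [List.mem_cons, List.mem_map] at hy
        rcases hy with rfl | rfl | ⟨b, hb, rfl⟩
        · simp
        · right; exact ⟨x, by simp, rfl⟩
        · right; exact ⟨b, by simp [hb], rfl⟩
    · obtain ⟨h1, h2, h3⟩ := ih hp.2 (fun y hy => hs y (by simp [hy])) m' hm'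
      refine ⟨by simp [h1], ?_, ?_⟩
      · rw [List.pairwise_cons]
        refine ⟨?_, h2⟩
        intro y hy
        rcases h3 y hy with h | ⟨z, hz, rfl⟩
        · exact hp.1 y h
        · exact le_up (hp.1 z hz) hx
      · intro y hy
        rcases List.mem_cons.1 hy with rfl | hy
        · simp
        · rcases h3 y hy with h | ⟨z, hz, rfl⟩
          · left; simp [h]
          · right; exact ⟨z, by simp [hz], rfl⟩

lemma up_supp {k : ℕ} {x : P} (h : ∀ i, k ≤ i → x i = 0) : ∀ i, k + 1 ≤ i → up k x i = 0 := by
  intro i hi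
  have : i ≠ k := by omega
  simp [up, this, h i (by omega)]

lemma up_nz {k : ℕ} {x : P} : ∃ i < k + 1, up k x i ≠ 0 := ⟨k, by omega, by simp [up]⟩

lemma D_valid {k : ℕ} {l : List P} (h : Valid k l) : ∀ m ∈ D k l, Valid (k + 1) m := by
  intro m hm
  rcases List.mem_cons.1 hm with rfl | hm
  · refine ⟨by simp [h.len], ?_, ?_, ?_⟩
    · simp only [List.pairwise_cons, List.mem_map, List.pairwise_map]
      refine ⟨?_, h.pw.imp up_le_up⟩
      rintro a ⟨b, hb, rfl⟩
      exact up_le_up (fun i => Or.inl rfl)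
    · intro x hx
      simp only [List.mem_cons, List.mem_map] at hx
      rcases hx with rfl | ⟨b, hb, rfl⟩ <;> exact up_nz
    · intro x hx
      simp only [List.mem_cons, List.mem_map] at hx
      rcases hx with rfl | ⟨b, hb, rfl⟩
      · exact up_supp (fun i _ => rfl)
      · exact up_supp (h.supp b hb)
  · obtain ⟨h1, h2, h3⟩ := G_spec k l h.pw (fun x hx => h.supp x hx k le_rfl) m hm
    refine ⟨by rw [h1, h.len], h2, ?_, ?_⟩
    · intro x hx
      rcases h3 x hx with hx | ⟨b, hb, rfl⟩
      · obtain ⟨i, hi, h⟩ := h.nz x hx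
        exact ⟨i, by omega, h⟩
      · exact up_nz
    · intro x hx
      rcases h3 x hx with hx | ⟨b, hb, rfl⟩
      · exact fun i hi => h.supp x hx i (by omega)
      · exact up_supp (h.supp b hb)

lemma neg_valid {k : ℕ} {l : List P} (h : Valid k l) : Valid k (neg l) := by
  refine ⟨by simp [neg, h.len], ?_, ?_, ?_⟩
  · simp only [neg, List.pairwise_map]
    refine h.pw.imp ?_
    intro a b hab i
    rcases hab i with h | h <;> simp [h]
  · intro x hx
    simp only [neg, List.mem_map] at hx
    obtain ⟨y, hy, rfl⟩ := hx
    obtain ⟨i, hi, h⟩ := h.nz y hy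
    refine ⟨i, hi, ?_⟩
    revert h; simp only [Pi.neg_apply]; cases y i <;> decide
  · intro x hx
    simp only [neg, List.mem_map] at hx
    obtain ⟨y, hy, rfl⟩ := hx
    intro i hi
    simp [h.supp y hy i hi]

lemma Z_valid (k : ℕ) : ∀ l ∈ Z k, Valid k l := by
  induction k with
  | zero => intro l hl; simp [Z] at hl; subst hl; exact ⟨rfl, by simp, by simp, by simp⟩
  | succ k ih =>
    have : ∀ l ∈ (Z k).flatMap (D k), Valid (k+1) l := by
      intro l hl
      obtain ⟨m, hm, hl⟩ := List.mem_flatMap.1 hl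
      exact D_valid (ih m hm) l hl
    intro l hl
    rcases List.mem_append.1 hl with hl | hl
    · exact this l hl
    · obtain ⟨m, hm, rfl⟩ := List.mem_map.1 hl
      exact neg_valid (this m hm)

/-- Octahedral Tucker lemma. -/
theorem tucker (n : ℕ) (hn : 1 ≤ n) (mag : P → ℕ) (sg : P → Bool)
    (hmag : ∀ x : P, (∃ i < n, x i ≠ 0) → mag (-x) = mag x)
    (hsg : ∀ x : P, (∃ i < n, x i ≠ 0) → sg (-x) = !sg x)
    (hlt : ∀ x : P, (∃ i < n, x i ≠ 0) → mag x < n - 1)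
    (hc : ∀ x y : P, (∃ i < n, x i ≠ 0) → (∃ i < n, y i ≠ 0) → le x y →
      mag x = mag y → sg x = sg y) : False := by
  let lab : P → ℕ := fun x => 2 * mag x + (sg x).toNat
  have hl2 : ∀ x, lab x / 2 = mag x := by
    intro x; simp only [lab]; cases sg x <;> simp <;> omega
  have hflip : ∀ x : P, (∃ i < n, x i ≠ 0) → lab (-x) = flip (lab x) := by
    intro x hx
    simp only [lab, hmag x hx, hsg x hx, flip]
    cases sg x <;> simp
  let al : Bool → List P → ZMod 2 := fun s l => beta s (srt (l.map lab))
  have hNC : ∀ k ≤ n, ∀ l, Valid k l → NC (l.map lab) := by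
    intro k hk l hl a ha b hb hab
    obtain ⟨x, hx, rfl⟩ := List.mem_map.1 ha
    obtain ⟨y, hy, rfl⟩ := List.mem_map.1 hb
    rw [hl2, hl2] at hab
    have hx' : ∃ i < n, x i ≠ 0 := by
      obtain ⟨i, hi, h⟩ := hl.nz x hx; exact ⟨i, by omega, h⟩
    have hy' : ∃ i < n, y i ≠ 0 := by
      obtain ⟨i, hi, h⟩ := hl.nz y hy; exact ⟨i, by omega, h⟩
    have : sg x = sg y := by
      by_cases hxy : x = y
      · rw [hxy]
      · haveI : Std.Symm (fun x y : P => le x y ∨ le y x) := ⟨fun _ _ h => h.symm⟩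
        have := List.Pairwise.forall_of_forall (R := fun x y => le x y ∨ le y x)
          (fun x _ => Or.inl (le_refl' x)) (hl.pw.imp Or.inl) hx hy
        rcases this with h | h
        · exact hc x y hx' hy' h hab
        · exact (hc y x hy' hx' h hab.symm).symm
    simp only [lab, hab, this]
  have hneg : ∀ k ≤ n, ∀ l, Valid k l → ∀ s, al s (neg l) = al (!s) l := by
    intro k hk l hl s
    simp only [al]
    rw [← beta_srt_flip _ _ (hNC k hk l hl)]
    congr 2
    simp only [neg, List.map_map]
    apply List.map_congr_left
    intro x hx
    obtain ⟨i, hi, h⟩ := hl.nz x hx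
    exact hflip x ⟨i, by omega, h⟩
  have hbd : ∀ s l, E (al s) (bd l) = al s l + al (!s) l := by
    intro s l
    simp only [al]
    rw [← beta_srt_bd, bd_map, E_map]
  have key : ∀ k ≤ n, E (al true) (Z k) = 1 := by
    intro k
    induction k with
    | zero => intro _; simp [Z, E, al, srt, beta]
    | succ k ih =>
      intro hk
      have hv : ∀ l ∈ (Z k).flatMap (D k), Valid (k+1) l := by
        intro l hl
        exact Z_valid (k+1) l (List.mem_append_left _ hl)
      have h1 : E (al true) (Z (k+1)) =
          E (fun l => E (al true) (bd l)) ((Z k).flatMap (D k)) := by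
        simp only [Z, E_append, E_map]
        rw [E_congr (fun l hl => hneg (k+1) hk l (hv l hl) true), ← E_add]
        exact E_congr (fun l _ => (hbd true l).symm)
      rw [h1, E_flatMap]
      simp only [D_bd, E_add, Z_bd, add_zero]
      exact ih (by omega)
  have h0 : E (al true) (Z n) = 0 := by
    apply E_zero
    intro l hl
    have hv := Z_valid n l hl
    by_contra hne
    have hp := srt_perm (l.map lab)
    have := beta_len (n - 1) _ true 0 hne (srt_sorted _) ?_ ?_ (by omega)
    · rw [hp.length_eq, List.length_map, hv.len] at this
      omega
    · intro a ha b hb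
      exact hNC n le_rfl l hv a (hp.mem_iff.1 ha) b (hp.mem_iff.1 hb)
    · intro a ha
      obtain ⟨x, hx, rfl⟩ := List.mem_map.1 (hp.mem_iff.1 ha)
      rw [hl2]
      exact ⟨by omega, hlt x (hv.nz x hx)⟩
  rw [key n le_rfl] at h0
  exact one_ne_zero h0

/-! alternation -/

def alt (x : P) : SignType → ℕ → ℕ
  | _, 0 => 0
  | s, n + 1 => if x n = s then 1 + alt x (-s) n else alt x s n

lemma alt_le (x : P) (n : ℕ) : ∀ s, s ≠ 0 → alt x s n ≤ 1 + alt x (-s) n := by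
  induction n with
  | zero => intro s _; simp [alt]
  | succ n ih =>
    intro s hs
    have h1 := ih s hs
    have h2 := ih (-s) (by revert hs; cases s <;> decide)
    rw [neg_neg] at h2
    simp only [alt, neg_neg]
    split_ifs with h3 h4 <;> omega

lemma alt_mono {x y : P} (h : le x y) (n : ℕ) : ∀ s, s ≠ 0 → alt x s n ≤ alt y s n := by
  induction n with
  | zero => intro s _; simp [alt]
  | succ n ih =>
    intro s hs
    have h1 := ih s hs
    have h2 := ih (-s) (by revert hs; cases s <;> decide)
    have h3 := alt_le y n s hs
    simp only [alt]
    split_ifs with h4 h5 <;> try omega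
    · rcases h n with h | h
      · rw [h4] at h; exact absurd h hs
      · exact absurd (h.symm.trans h4) h5

lemma alt_neg (x : P) (n : ℕ) : ∀ s, alt (-x) s n = alt x (-s) n := by
  induction n with
  | zero => intro s; rfl
  | succ n ih =>
    intro s
    have : (-x) n = s ↔ x n = -s := by
      simp only [Pi.neg_apply]; generalize x n = t; revert s t; decide
    simp only [alt, ih, this]

lemma alt_ne (x : P) (n : ℕ) (h : ∃ i < n, x i ≠ 0) : alt x 1 n ≠ alt x (-1) n := by
  induction n with
  | zero => obtain ⟨i, hi, _⟩ := h; omega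
  | succ n ih =>
    have h1 := alt_le x n 1 (by decide)
    have h2 := alt_le x n (-1) (by decide)
    rw [neg_neg] at h2
    simp only [alt, neg_neg]
    by_cases hx : x n = 0
    · have h3 : ¬ x n = 1 := by rw [hx]; decide
      have h4 : ¬ x n = -1 := by rw [hx]; decide
      rw [if_neg h3, if_neg h4]
      apply ih
      obtain ⟨i, hi, hi'⟩ := h
      refine ⟨i, ?_, hi'⟩
      by_contra hh
      have : i = n := by omega
      rw [this] at hi'; exact hi' hx
    · have h5 : x n = 1 ∨ x n = -1 := by revert hx; generalize x n = t; revert t; decide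
      by_cases hm : x n = 1
      · have h4 : ¬ x n = -1 := by rw [hm]; decide
        rw [if_pos hm, if_neg h4]; omega
      · have h4 := h5.resolve_left hm
        rw [if_neg hm, if_pos h4]; omega

lemma extract (x : P) (s : SignType) (c : ℕ) (hc : c ≤ 1) (n : ℕ) : ∀ k,
    (2 * k ≤ alt x s n + c → ∃ S : Finset ℕ, S.card = k ∧ (∀ i ∈ S, x i = s ∧ i < n ∧ i + 1 ∉ S) ∧
      (c = 0 → 0 ∉ S)) ∧
    (2 * k + 1 ≤ alt x (-s) n + c → ∃ S : Finset ℕ, S.card = k ∧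
      (∀ i ∈ S, x i = s ∧ i + 1 < n ∧ i + 1 ∉ S) ∧ (c = 0 → 0 ∉ S)) := by
  induction n with
  | zero =>
    intro k
    simp only [alt]
    constructor
    · intro h
      exact ⟨∅, by simp; omega, by simp, by simp⟩
    · intro h
      exact ⟨∅, by simp; omega, by simp, by simp⟩
  | succ n ih =>
    intro k
    simp only [alt, neg_neg]
    constructor
    · intro h
      split_ifs at h with hx
      · cases k with
        | zero => exact ⟨∅, by simp, by simp, by simp⟩
        | succ j =>
          obtain ⟨S, h1, h2, h3⟩ := (ih j).2 (by omega)
          have hn : n ∉ S := fun hh => by have := (h2 n hh).2.1; omega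
          refine ⟨insert n S, by rw [Finset.card_insert_of_notMem hn, h1], ?_, ?_⟩
          · intro i hi
            rcases Finset.mem_insert.1 hi with rfl | hi
            · refine ⟨hx, by omega, ?_⟩
              intro hh
              rcases Finset.mem_insert.1 hh with hh | hh
              · omega
              · have := (h2 _ hh).2.1; omega
            · obtain ⟨h4, h5, h6⟩ := h2 i hi
              refine ⟨h4, by omega, ?_⟩
              intro hh
              rcases Finset.mem_insert.1 hh with hh | hh
              · omega
              · exact h6 hh
          · intro hc0 hh
            rcases Finset.mem_insert.1 hh with hh | hh
            · subst hh; subst hc0; simp [alt] at h; omega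
            · exact h3 hc0 hh
      · obtain ⟨S, h1, h2, h3⟩ := (ih k).1 h
        exact ⟨S, h1, fun i hi => ⟨(h2 i hi).1, by have := (h2 i hi).2.1; omega, (h2 i hi).2.2⟩, h3⟩
    · intro h
      split_ifs at h with hx
      · obtain ⟨S, h1, h2, h3⟩ := (ih k).1 (by omega)
        exact ⟨S, h1, fun i hi => ⟨(h2 i hi).1, by have := (h2 i hi).2.1; omega, (h2 i hi).2.2⟩, h3⟩
      · obtain ⟨S, h1, h2, h3⟩ := (ih k).2 h
        exact ⟨S, h1, fun i hi => ⟨(h2 i hi).1, by have := (h2 i hi).2.1; omega, (h2 i hi).2.2⟩, h3⟩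

lemma shift_stable (n k : ℕ) (S : Finset ℕ) (h1 : S.card = k) (h2 : ∀ i ∈ S, i < n ∧ i + 1 ∉ S)
    (h3 : 0 ∉ S ∨ ∀ i ∈ S, i + 1 < n) :
    S.image (· + 1) ⊆ Finset.Icc 1 n ∧ (S.image (· + 1)).card = k ∧
      IsStable n (S.image (· + 1)) := by
  have hm : ∀ i, i ∈ S.image (· + 1) ↔ ∃ j ∈ S, j + 1 = i := by simp
  refine ⟨?_, ?_, ?_, ?_⟩
  · intro i hi
    obtain ⟨j, hj, rfl⟩ := (hm i).1 hi
    have := (h2 j hj).1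
    simp; omega
  · rw [Finset.card_image_of_injective _ (fun a b h => by simpa using h), h1]
  · rintro i - ⟨ha, hb⟩
    obtain ⟨j, hj, rfl⟩ := (hm i).1 ha
    obtain ⟨j', hj', h⟩ := (hm _).1 hb
    have : j' = j + 1 := by omega
    subst this
    exact (h2 j hj).2 hj'
  · rintro ⟨ha, hb⟩
    obtain ⟨j, hj, hjn⟩ := (hm _).1 ha
    obtain ⟨j', hj', h⟩ := (hm _).1 hb
    have : j' = 0 := by omega
    subst this
    rcases h3 with h3 | h3
    · exact h3 hj'
    · have := h3 j hj; omega

/-- `x` has a strict majority of sign `s` on `V`. -/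
def Maj (V : Finset ℕ) (s : SignType) (x : P) : Prop :=
  V.card < 2 * (V.filter (fun v => x (v - 1) = s)).card

lemma Maj_neg (V : Finset ℕ) (s : SignType) (x : P) : Maj V s (-x) ↔ Maj V (-s) x := by
  unfold Maj
  have : ∀ v, (-x) (v - 1) = s ↔ x (v - 1) = -s := by
    intro v
    simp only [Pi.neg_apply]; generalize x (v - 1) = t; revert s t; decide
  simp only [this]

lemma Maj_excl (V : Finset ℕ) {s : SignType} (hs : s ≠ 0) {x y : P} (h : le x y)
    (hx : Maj V s x) (hy : Maj V (-s) y) : False := by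
  unfold Maj at hx hy
  have hd : Disjoint (V.filter (fun v => x (v - 1) = s)) (V.filter (fun v => y (v - 1) = -s)) := by
    rw [Finset.disjoint_left]
    intro v hv hv'
    have h1 := (Finset.mem_filter.1 hv).2
    have h2 := (Finset.mem_filter.1 hv').2
    rcases h (v - 1) with h | h
    · exact hs (h1.symm.trans h)
    · rw [h1, h2] at h; revert h hs; cases s <;> decide
  have h1 := Finset.card_union_of_disjoint hd
  have h2 := Finset.card_le_card (Finset.union_subset
    (Finset.filter_subset (fun v => x (v - 1) = s) V)
    (Finset.filter_subset (fun v => y (v - 1) = -s) V))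
  omega

end Tuck

/-- Given `ℓ ≤ n-2k+1` subsets `V_1, ..., V_ℓ` of `[n]`, each of size at least `2`,
there is a stable `k`-subset `S` of `[n]` with `|S ∩ V_i| ≤ |V_i|/2` for all `i`. -/
theorem stmt2 (n k ℓ : ℕ) (hk : 1 ≤ k) (hn : 2 * k ≤ n)
    (hℓ : ℓ ≤ n - 2 * k + 1) (V : Fin ℓ → Finset ℕ)
    (hV : ∀ i, V i ⊆ Finset.Icc 1 n) (hV2 : ∀ i, 2 ≤ (V i).card) :
    ∃ S : Finset ℕ, S ⊆ Finset.Icc 1 n ∧ S.card = k ∧ IsStable n S ∧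
      ∀ i, 2 * (S ∩ V i).card ≤ (V i).card := by
  classical
  by_contra hcon
  push Not at hcon
  let W : ℕ → Finset ℕ := fun i => if h : i < ℓ then V ⟨i, h⟩ else ∅
  have hWl : ∀ i s x, Tuck.Maj (W i) s x → i < ℓ := by
    intro i s x h
    by_contra hh
    simp [W, hh, Tuck.Maj] at h
  -- large alternation on both sides
  have hbad : ∀ (x : Tuck.P) (s : SignType) (S : Finset ℕ), S.card = k →
      (∀ i ∈ S, x i = s ∧ i < n ∧ i + 1 ∉ S) → (0 ∉ S ∨ ∀ i ∈ S, i + 1 < n) →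
      ∃ i, Tuck.Maj (W i) s x := by
    intro x s S h1 h2 h3
    obtain ⟨h4, h5, h6⟩ := Tuck.shift_stable n k S h1 (fun i hi => (h2 i hi).2) h3
    obtain ⟨i, hi⟩ := hcon _ h4 h5 h6
    refine ⟨i, ?_⟩
    have hW : W i = V i := by simp [W]
    rw [hW]
    unfold Tuck.Maj
    refine lt_of_lt_of_le hi (Nat.mul_le_mul_left 2 (Finset.card_le_card ?_))
    intro v hv
    obtain ⟨hv1, hv2⟩ := Finset.mem_inter.1 hv
    obtain ⟨j, hj, rfl⟩ := Finset.mem_image.1 hv1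
    exact Finset.mem_filter.2 ⟨hv2, by simpa using (h2 j hj).1⟩
  have hboth : ∀ (x : Tuck.P) (s : SignType), 2 * k ≤ Tuck.alt x s n →
      (∃ i, Tuck.Maj (W i) s x) ∧ ∃ i, Tuck.Maj (W i) (-s) x := by
    intro x s h
    constructor
    · obtain ⟨S, h1, h2, h3⟩ := (Tuck.extract x s 0 (by omega) n k).1 (by omega)
      exact hbad x s S h1 h2 (Or.inl (h3 rfl))
    · obtain ⟨S, h1, h2, h3⟩ := (Tuck.extract x (-s) 1 (by omega) n k).2
        (by rw [neg_neg]; omega)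
      exact hbad x (-s) S h1 (fun i hi => ⟨(h2 i hi).1, by have := (h2 i hi).2.1; omega,
        (h2 i hi).2.2⟩) (Or.inr (fun i hi => (h2 i hi).2.1))
  let A : Tuck.P → ℕ := fun x => max (Tuck.alt x 1 n) (Tuck.alt x (-1) n)
  let idx : Tuck.P → ℕ := fun x =>
    Nat.findGreatest (fun i => Tuck.Maj (W i) 1 x ∨ Tuck.Maj (W i) (-1) x) ℓ
  have hA2 : ∀ x, 2 * k ≤ A x → (∃ i, Tuck.Maj (W i) 1 x) ∧ ∃ i, Tuck.Maj (W i) (-1) x := by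
    intro x h
    rcases le_max_iff.1 h with h | h
    · exact hboth x 1 h
    · have := hboth x (-1) h
      rw [neg_neg] at this
      exact this.symm
  have hidx : ∀ x, 2 * k ≤ A x →
      (Tuck.Maj (W (idx x)) 1 x ∨ Tuck.Maj (W (idx x)) (-1) x) ∧ 1 ≤ idx x ∧ idx x < ℓ := by
    intro x h
    obtain ⟨⟨i, hi⟩, ⟨j, hj⟩⟩ := hA2 x h
    have hil := hWl _ _ _ hi
    have hjl := hWl _ _ _ hj
    have h1 : i ≤ idx x := Nat.le_findGreatest hil.le (Or.inl hi)
    have h2 : j ≤ idx x := Nat.le_findGreatest hjl.le (Or.inr hj)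
    have hij : i ≠ j := by
      rintro rfl
      exact Tuck.Maj_excl (W i) (by decide) (Tuck.le_refl' x) hi hj
    have h3 : Tuck.Maj (W (idx x)) 1 x ∨ Tuck.Maj (W (idx x)) (-1) x :=
      Nat.findGreatest_spec (P := fun i => Tuck.Maj (W i) 1 x ∨ Tuck.Maj (W i) (-1) x)
        hil.le (Or.inl hi)
    refine ⟨h3, by omega, ?_⟩
    rcases h3 with h3 | h3 <;> exact hWl _ _ _ h3
  have hAneg : ∀ x, A (-x) = A x := by
    intro x
    simp only [A, Tuck.alt_neg, neg_neg]
    exact max_comm _ _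
  have hineg : ∀ x, idx (-x) = idx x := by
    intro x
    simp only [idx, Tuck.Maj_neg, neg_neg]
    congr 1
    funext i
    exact propext or_comm
  have hApos : ∀ x : Tuck.P, (∃ i < n, x i ≠ 0) → 1 ≤ A x := by
    intro x hx
    have := Tuck.alt_ne x n hx
    simp only [A]
    omega
  refine Tuck.tucker n (by omega)
    (fun x => if A x < 2 * k then A x - 1 else 2 * k - 2 + idx x)
    (fun x => if A x < 2 * k then decide (Tuck.alt x (-1) n < Tuck.alt x 1 n)
      else decide (Tuck.Maj (W (idx x)) 1 x)) ?_ ?_ ?_ ?_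
  · intro x _
    simp only [hAneg, hineg]
  · intro x hx
    have hne := Tuck.alt_ne x n hx
    simp only [hAneg, hineg]
    split_ifs with h
    · simp only [Tuck.alt_neg, neg_neg]
      rw [← decide_not, decide_eq_decide]
      omega
    · rw [← decide_not, decide_eq_decide, Tuck.Maj_neg]
      have h1 := (hidx x (by omega)).1
      constructor
      · intro h2 h3
        exact Tuck.Maj_excl _ (by decide) (Tuck.le_refl' x) h3 h2
      · intro h2
        exact h1.resolve_left h2
  · intro x hx
    have h1 := hApos x hx
    beta_reduce
    split_ifs with h
    · omega
    · have := hidx x (by omega)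
      omega
  · intro x y hx hy hxy hm
    have hx1 := hApos x hx
    have hy1 := hApos y hy
    have hxn := Tuck.alt_ne x n hx
    have hyn := Tuck.alt_ne y n hy
    beta_reduce at hm ⊢
    by_cases h1 : A x < 2 * k <;> by_cases h2 : A y < 2 * k
    · rw [if_pos h1, if_pos h2] at hm ⊢
      have h3 := Tuck.alt_mono hxy n 1 (by decide)
      have h4 := Tuck.alt_mono hxy n (-1) (by decide)
      rw [decide_eq_decide]
      simp only [A] at hm hx1 hy1
      omega
    · rw [if_pos h1, if_neg h2] at hm
      have := hidx y (by omega)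
      omega
    · rw [if_neg h1, if_pos h2] at hm
      have := hidx x (by omega)
      omega
    · rw [if_neg h1, if_neg h2] at hm ⊢
      have h3 : idx x = idx y := by omega
      have h4 := (hidx x (by omega)).1
      have h5 := (hidx y (by omega)).1
      rw [h3] at h4 ⊢
      rw [decide_eq_decide]
      constructor
      · intro h
        refine h5.resolve_right (fun h' => ?_)
        exact Tuck.Maj_excl _ (by decide) hxy h h'
      · intro h
        refine h4.resolve_right (fun h' => ?_)
        exact Tuck.Maj_excl (s := -1) _ (by decide) hxy h' (by rw [neg_neg]; exact h)
end

section
/- For all integers k ≥ 2 and n ≥ 2k, the independence number of U(n,k) equals C(n-1, k-1) − C(n-k-1, k-1). -/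
/-- A subset `A` of `[n] = {1,...,n}` is unstable if it contains two cyclically
consecutive elements: some `i` with `i, i+1 ∈ A`, or both `n` and `1`. -/
def IsUnstable (n : ℕ) (A : Finset ℕ) : Prop :=
  (∃ i, i ∈ A ∧ i + 1 ∈ A) ∨ (n ∈ A ∧ 1 ∈ A)
namespace HM
open Finset

def Unif (V : Finset ℕ) (a : ℕ) (A : Finset (Finset ℕ)) : Prop := ∀ S ∈ A, S ⊆ V ∧ #S = a
def Cross (A B : Finset (Finset ℕ)) : Prop := ∀ S ∈ A, ∀ T ∈ B, ∃ x, x ∈ S ∧ x ∈ T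
def Sh (V : Finset ℕ) (A : Finset (Finset ℕ)) : Prop :=
  ∀ i ∈ V, ∀ j ∈ V, i < j → ∀ S ∈ A, j ∈ S → i ∉ S → insert i (S.erase j) ∈ A
def link (m : ℕ) (A : Finset (Finset ℕ)) : Finset (Finset ℕ) := {S ∈ A | m ∈ S}.image (fun S => S.erase m)
def del (m : ℕ) (A : Finset (Finset ℕ)) : Finset (Finset ℕ) := {S ∈ A | m ∉ S}

lemma mem_link {m : ℕ} {A : Finset (Finset ℕ)} {S : Finset ℕ} :
    S ∈ link m A ↔ m ∉ S ∧ insert m S ∈ A := by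
  unfold link
  simp only [mem_image, mem_filter]
  constructor
  · rintro ⟨T, ⟨hT, hm⟩, rfl⟩
    simp [insert_erase hm, hT]
  · rintro ⟨h1, h2⟩
    exact ⟨_, ⟨h2, mem_insert_self _ _⟩, erase_insert h1⟩

lemma mem_del {m : ℕ} {A : Finset (Finset ℕ)} {S : Finset ℕ} :
    S ∈ del m A ↔ S ∈ A ∧ m ∉ S := by simp [del]

lemma card_link_del (m : ℕ) (A : Finset (Finset ℕ)) : #(link m A) + #(del m A) = #A := by
  unfold link del
  rw [card_image_of_injOn, card_filter_add_card_filter_not]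
  intro S hS T hT h
  simp at hS hT h
  rw [← insert_erase hS.2, ← insert_erase hT.2, h]

lemma Unif.del {V : Finset ℕ} {a m : ℕ} {A} (h : Unif V a A) : Unif (V.erase m) a (del m A) := by
  intro S hS
  rw [mem_del] at hS
  refine ⟨fun x hx => mem_erase.2 ⟨?_, (h S hS.1).1 hx⟩, (h S hS.1).2⟩
  rintro rfl; exact hS.2 hx

lemma Unif.link {V : Finset ℕ} {a m : ℕ} {A} (h : Unif V (a+1) A) : Unif (V.erase m) a (link m A) := by
  intro S hS
  rw [mem_link] at hS
  have h2 := h _ hS.2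
  refine ⟨fun x hx => mem_erase.2 ⟨?_, h2.1 (mem_insert_of_mem hx)⟩, ?_⟩
  · rintro rfl; exact hS.1 hx
  · have := h2.2; rw [card_insert_of_notMem hS.1] at this; omega

lemma Unif.sub {V : Finset ℕ} {a : ℕ} {A} (h : Unif V a A) : A ⊆ V.powersetCard a := by
  intro S hS; rw [mem_powersetCard]; exact h S hS

lemma Sh.del {V : Finset ℕ} {m : ℕ} {A} (h : Sh V A) : Sh (V.erase m) (del m A) := by
  intro i hi j hj hij S hS hjS hiS
  rw [mem_del] at hS ⊢
  simp only [mem_erase] at hi hj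
  refine ⟨h i hi.2 j hj.2 hij S hS.1 hjS hiS, ?_⟩
  simp only [mem_insert, mem_erase, not_or]
  exact ⟨fun h => hi.1 h.symm, fun h => hS.2 h.2⟩

lemma Sh.link {V : Finset ℕ} {m : ℕ} {A} (h : Sh V A) : Sh (V.erase m) (link m A) := by
  intro i hi j hj hij S hS hjS hiS
  rw [mem_link] at hS ⊢
  simp only [mem_erase] at hi hj
  have := h i hi.2 j hj.2 hij _ hS.2 (mem_insert_of_mem hjS) (by simp [hi.1, hiS])
  refine ⟨?_, ?_⟩
  · simp only [mem_insert, mem_erase, not_or]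
    exact ⟨fun h => hi.1 h.symm, fun h => hS.1 h.2⟩
  · convert this using 1
    rw [erase_insert_of_ne (fun h => hj.1 h.symm)]
    exact Finset.insert_comm _ _ _

/-- replace the maximum -/
lemma repl {V : Finset ℕ} {m : ℕ} {A} (hV : ∀ x ∈ V, x ≤ m) (hmV : m ∈ V) (h : Sh V A)
    {S X : Finset ℕ} (hS : S ∈ A) (hX : Disjoint S X) (hc : #S + #X < #V) :
    ∃ S' ∈ A, m ∉ S' ∧ Disjoint S' X := by
  by_cases hm : m ∈ S
  · have : ∃ c ∈ V, c ∉ S ∪ X := by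
      by_contra! hh
      have := card_le_card (show V ⊆ S ∪ X from hh)
      have := card_union_le S X
      omega
    obtain ⟨c, hcV, hc⟩ := this
    simp only [mem_union, not_or] at hc
    have hcm : c ≠ m := by rintro rfl; exact hc.1 hm
    refine ⟨_, h c hcV m hmV (lt_of_le_of_ne (hV c hcV) hcm) S hS hm hc.1, ?_, ?_⟩
    · simp [hcm.symm]
    · rw [disjoint_insert_left]
      exact ⟨hc.2, hX.mono_left (erase_subset _ _)⟩
  · exact ⟨S, hS, hm, hX⟩

/-- links cross-intersect -/
lemma link_cross {V : Finset ℕ} {m a : ℕ} {A B} (hV : ∀ x ∈ V, x ≤ m) (hmV : m ∈ V) (h : Sh V A)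
    (hA : Unif V (a+1) A) (hB : Unif V (a+1) B) (hc : Cross A B) (hn : 2 * (a + 1) ≤ #V) :
    Cross (link m A) (link m B) := by
  intro S hS T hT
  by_contra! hh
  have hS' := (hA.link S hS).2
  have hT' := (hB.link T hT).2
  rw [mem_link] at hS hT
  have : ∃ c ∈ V, c ∉ insert m (S ∪ T) := by
    by_contra! hh
    have := card_le_card (show V ⊆ insert m (S ∪ T) from hh)
    have := card_union_le S T
    have := card_insert_le m (S ∪ T)
    omega
  obtain ⟨c, hcV, hc'⟩ := this
  simp only [mem_insert, mem_union, not_or] at hc'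
  have := h c hcV m hmV (lt_of_le_of_ne (hV c hcV) hc'.1) _ hS.2 (mem_insert_self _ _) (by simp [hc'])
  rw [erase_insert hS.1] at this
  obtain ⟨x, hx, hy⟩ := hc _ this _ hT.2
  simp only [mem_insert] at hx hy
  grind

lemma link_meets {m : ℕ} {A B} (hc : Cross A B) {S T : Finset ℕ} (hS : S ∈ link m A) (hT : T ∈ B) (hm : m ∉ T) :
    ¬ Disjoint S T := by
  rw [mem_link] at hS
  obtain ⟨x, hx, hy⟩ := hc _ hS.2 _ hT
  rw [not_disjoint_iff]
  refine ⟨x, ?_, hy⟩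
  rw [mem_insert] at hx
  rcases hx with rfl | hx
  · exact absurd hy hm
  · exact hx

lemma Cross.symm {A B} (h : Cross A B) : Cross B A := fun S hS T hT => by
  obtain ⟨x, hx, hy⟩ := h T hT S hS
  exact ⟨x, hy, hx⟩

lemma card_meet {W G : Finset ℕ} {r : ℕ} {A} (hA : Unif W r A) (hG : G ⊆ W)
    (hm : ∀ S ∈ A, ¬ Disjoint S G) : #A + (#W - #G).choose r ≤ (#W).choose r := by
  have h1 : Disjoint A ((W \ G).powersetCard r) := by
    rw [disjoint_left]
    intro S hS hS'
    rw [mem_powersetCard] at hS'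
    exact hm S hS (disjoint_of_subset_left hS'.1 sdiff_disjoint)
  have h2 : A ∪ ((W \ G).powersetCard r) ⊆ W.powersetCard r :=
    union_subset hA.sub (powersetCard_mono sdiff_subset)
  have := card_le_card h2
  rwa [card_union_of_disjoint h1, card_powersetCard, card_powersetCard, card_sdiff_of_subset hG] at this

lemma card_meet' {W G R : Finset ℕ} {r : ℕ} {A} (hA : Unif W r A) (hG : G ⊆ W)
    (hm : ∀ S ∈ A, ¬ Disjoint S G) (hR : R ⊆ W) (hR' : #R = r) (hRG : ¬ Disjoint R G) (hRA : R ∉ A) :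
    #A + (#W - #G).choose r + 1 ≤ (#W).choose r := by
  have : Unif W r (insert R A) := by
    intro S hS
    rw [mem_insert] at hS
    rcases hS with rfl | hS
    exacts [⟨hR, hR'⟩, hA S hS]
  have := card_meet this hG (by
    intro S hS
    rw [mem_insert] at hS
    rcases hS with rfl | hS
    exacts [hRG, hm S hS])
  rw [card_insert_of_notMem hRA] at this
  omega

lemma card_all {W : Finset ℕ} {r : ℕ} {A} (hA : Unif W r A) : #A ≤ (#W).choose r := by
  have := card_le_card hA.sub
  rwa [card_powersetCard] at this

/-- base case -/
lemma cross_base {V : Finset ℕ} {a : ℕ} {A B} (hA : Unif V a A) (hB : Unif V a B) (hc : Cross A B)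
    (hn : #V = 2 * a) : #A + #B ≤ (2 * a).choose a := by
  have hinj : Set.InjOn (fun S => V \ S) (B : Set (Finset ℕ)) := by
    intro S hS T hT h
    simp only at h
    rw [← Finset.sdiff_sdiff_eq_self (hB S hS).1, h, Finset.sdiff_sdiff_eq_self (hB T hT).1]
  have hd : Disjoint A (B.image (fun S => V \ S)) := by
    rw [disjoint_left]
    intro S hS hS'
    rw [mem_image] at hS'
    obtain ⟨T, hT, rfl⟩ := hS'
    obtain ⟨x, hx, hy⟩ := hc _ hS T hT
    simp at hx
    exact hx.2 hy
  have hs : A ∪ (B.image (fun S => V \ S)) ⊆ V.powersetCard a := by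
    apply union_subset hA.sub
    intro S hS
    rw [mem_image] at hS
    obtain ⟨T, hT, rfl⟩ := hS
    rw [mem_powersetCard]
    refine ⟨sdiff_subset, ?_⟩
    rw [card_sdiff_of_subset (hB T hT).1, (hB T hT).2]; omega
  have := card_le_card hs
  rwa [card_union_of_disjoint hd, card_image_of_injOn hinj, card_powersetCard, hn] at this

lemma Cross.del {m A B} (h : Cross A B) : Cross (del m A) (del m B) := fun S hS T hT =>
  h S (mem_del.1 hS).1 T (mem_del.1 hT).1

theorem cross_sh : ∀ N : ℕ, ∀ V : Finset ℕ, #V = N → ∀ a A B, Unif V a A → Unif V a B → Sh V A → Sh V B →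
    Cross A B → A.Nonempty → B.Nonempty → 2 * a ≤ N → #A + #B + (N - a).choose a ≤ N.choose a + 1 := by
  intro N
  induction N with
  | zero =>
    intro V hV a A B hA hB sA sB hc neA neB ha
    obtain ⟨S, hS⟩ := neA
    obtain ⟨T, hT⟩ := neB
    obtain ⟨x, hx, -⟩ := hc S hS T hT
    have := (hA S hS).2
    have := card_pos.2 ⟨x, hx⟩
    omega
  | succ N ih =>
    intro V hV a A B hA hB sA sB hc neA neB ha
    rcases Nat.eq_or_lt_of_le ha with he | hlt
    · have := cross_base hA hB hc (by omega)
      rw [← he, show 2 * a - a = a by omega, Nat.choose_self]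
      omega
    · rcases a with _ | a
      · obtain ⟨S, hS⟩ := neA
        obtain ⟨T, hT⟩ := neB
        obtain ⟨x, hx, -⟩ := hc S hS T hT
        have := (hA S hS).2
        have := card_pos.2 ⟨x, hx⟩
        omega
      have hVne : V.Nonempty := card_pos.1 (by omega)
      set m := V.max' hVne with hm
      have hmV : m ∈ V := max'_mem _ _
      have hle : ∀ x ∈ V, x ≤ m := fun x hx => le_max' _ _ hx
      have hVc : #(V.erase m) = N := by rw [card_erase_of_mem hmV]; omega
      have ndel : ∀ {A}, Unif V (a+1) A → Sh V A → A.Nonempty → (del m A).Nonempty := by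
        rintro A hA sA ⟨S, hS⟩
        obtain ⟨S', h1, h2, -⟩ := repl hle hmV sA hS (disjoint_empty_right S) (by
          rw [(hA S hS).2]; simp; omega)
        exact ⟨S', mem_del.2 ⟨h1, h2⟩⟩
      have key : ∀ {A B}, Unif V (a+1) A → Unif V (a+1) B → Sh V A → Cross A B → A.Nonempty → link m A = ∅ →
          #(link m A) + #(link m B) + (N - (a+1)).choose a ≤ N.choose a := by
        intro A B hA hB sA hc neA he
        obtain ⟨S, hS⟩ := ndel hA sA neA
        have h1 := card_meet (hB.link (m := m)) (hA.del S hS).1 (fun T hT => by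
          rw [mem_del] at hS
          exact link_meets hc.symm hT hS.1 hS.2)
        rw [hVc, (hA.del S hS).2] at h1
        rw [he]; simpa using h1
      have hlink : #(link m A) + #(link m B) + (N - (a+1)).choose a ≤ N.choose a := by
        rcases (link m A).eq_empty_or_nonempty with h | h
        · exact key hA hB sA hc neA h
        rcases (link m B).eq_empty_or_nonempty with h' | h'
        · have := key hB hA sB hc.symm neB h'
          omega
        have lc := link_cross hle hmV sA hA hB hc (by omega)
        have := ih _ hVc a _ _ hA.link hB.link sA.link sB.link lc h h' (by omega)
        rcases a with _ | a
        · obtain ⟨S, hS⟩ := h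
          obtain ⟨T, hT⟩ := h'
          obtain ⟨x, hx, -⟩ := lc S hS T hT
          have := (hA.link S hS).2
          have := card_pos.2 ⟨x, hx⟩
          omega
        · rw [show N - (a+1) = (N - (a+1+1)) + 1 by omega, Nat.choose_succ_succ'] at this
          have := Nat.choose_pos (n := N - (a+1+1)) (k := a) (by omega)
          omega
      have hdel := ih _ hVc (a+1) _ _ hA.del hB.del sA.del sB.del hc.del (ndel hA sA neA) (ndel hB sB neB) (by omega)
      have e1 := card_link_del m A
      have e2 := card_link_del m B
      rw [show N + 1 - (a+1) = N - (a+1) + 1 by omega, Nat.choose_succ_succ', Nat.choose_succ_succ']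
      omega

/-- strict version -/
theorem cross_sh' : ∀ N : ℕ, ∀ V : Finset ℕ, #V = N → ∀ a A B, Unif V a A → Unif V a B → Sh V A → Sh V B →
    Cross A B → 2 ≤ #A → 2 ≤ #B → 3 ≤ a → 2 * a + 1 ≤ N → #A + #B + (N - a).choose a ≤ N.choose a := by
  intro N
  induction N with
  | zero => intros; omega
  | succ N ih =>
    intro V hV a A B hA hB sA sB hc neA neB ha3 ha
    obtain ⟨a, rfl⟩ : ∃ b, a = b + 1 := ⟨a - 1, by omega⟩
    have hVne : V.Nonempty := card_pos.1 (by omega)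
    set m := V.max' hVne with hm
    have hmV : m ∈ V := max'_mem _ _
    have hle : ∀ x ∈ V, x ≤ m := fun x hx => le_max' _ _ hx
    have hVc : #(V.erase m) = N := by rw [card_erase_of_mem hmV]; omega
    have ndel : ∀ {A}, Unif V (a+1) A → Sh V A → 2 ≤ #A → 2 ≤ #(del m A) := by
      intro A hA sA h2
      rcases (link m A).eq_empty_or_nonempty with h | ⟨S, hS⟩
      · have := card_link_del m A
        rw [h] at this; simp at this; omega
      · have hcS := (hA.link S hS)
        rw [mem_link] at hS
        have : 1 < #((V.erase m) \ S) := by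
          rw [card_sdiff_of_subset hcS.1, hcS.2]; omega
        obtain ⟨c, d, hcc, hd, hcd⟩ := one_lt_card_iff.1 this
        have hh : ∀ c, c ∈ (V.erase m) \ S → insert c S ∈ del m A := by
          intro c hc
          simp only [mem_sdiff, mem_erase] at hc
          have := sA c hc.1.2 m hmV (lt_of_le_of_ne (hle c hc.1.2) hc.1.1) _ hS.2 (mem_insert_self _ _)
            (by simp [hc])
          rw [erase_insert hS.1] at this
          rw [mem_del]
          refine ⟨this, ?_⟩
          simp only [mem_insert, not_or]
          exact ⟨fun h => hc.1.1 h.symm, hS.1⟩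
        apply one_lt_card_iff.2
        refine ⟨_, _, hh c hcc, hh d hd, ?_⟩
        intro he
        have : c ∈ insert d S := he ▸ mem_insert_self c S
        simp only [mem_sdiff] at hcc
        simp [hcd, hcc.2] at this
    have pos : ∀ {A : Finset (Finset ℕ)}, 2 ≤ #A → A.Nonempty := fun h => card_pos.1 (by omega)
    have key : ∀ {A B}, Unif V (a+1) A → Unif V (a+1) B → Sh V A → Cross A B → 2 ≤ #A → link m A = ∅ →
        #(link m A) + #(link m B) + (N - (a+1)).choose a + 1 ≤ N.choose a := by
      intro A B hA hB sA hc neA he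
      obtain ⟨S, T, hS, hT, hST⟩ := one_lt_card_iff.1 (ndel hA sA neA)
      have hS' := hA.del S hS
      have hT' := hA.del T hT
      have : ∃ s ∈ S, s ∉ T := by
        by_contra! hh
        exact hST (eq_of_subset_of_card_le hh (by omega))
      obtain ⟨s, hsS, hsT⟩ := this
      obtain ⟨R, hR1, hR2, hR3⟩ := exists_subsuperset_card_eq (s := {s}) (t := (V.erase m) \ T) (n := a)
        (by simp [hsT]; simpa using hS'.1 hsS) (by simp; omega)
        (by rw [card_sdiff_of_subset hT'.1, hT'.2]; omega)
      have h1 := card_meet' (R := R) (hB.link (m := m)) (hS').1 (fun T hT => by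
        rw [mem_del] at hS
        exact link_meets hc.symm hT hS.1 hS.2) (hR2.trans sdiff_subset) hR3
        (not_disjoint_iff.2 ⟨s, by simpa using hR1, hsS⟩)
        (fun h => link_meets hc.symm h (mem_del.1 hT).1 (mem_del.1 hT).2 
          (disjoint_of_subset_left hR2 sdiff_disjoint))
      rw [hVc, hS'.2] at h1
      rw [he]; simpa using h1
    have hlink : #(link m A) + #(link m B) + (N - (a+1)).choose a + 1 ≤ N.choose a := by
      rcases (link m A).eq_empty_or_nonempty with h | h
      · exact key hA hB sA hc neA h
      rcases (link m B).eq_empty_or_nonempty with h' | h'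
      · have := key hB hA sB hc.symm neB h'
        omega
      have lc := link_cross hle hmV sA hA hB hc (by omega)
      have := cross_sh N _ hVc a _ _ hA.link hB.link sA.link sB.link lc h h' (by omega)
      obtain ⟨a, rfl⟩ : ∃ b, a = b + 1 := ⟨a - 1, by omega⟩
      rw [show N - (a+1) = (N - (a+1+1)) + 1 by omega, Nat.choose_succ_succ'] at this
      have h2 : 2 ≤ (N - (a+1+1)).choose a := by
        calc 2 ≤ a + 1 := by omega
          _ = (a+1).choose a := by simp
          _ ≤ _ := Nat.choose_le_choose _ (by omega)
      omega
    have hdel := cross_sh N _ hVc (a+1) _ _ hA.del hB.del sA.del sB.del hc.del 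
      (pos (ndel hA sA neA)) (pos (ndel hB sB neB)) (by omega)
    have e1 := card_link_del m A
    have e2 := card_link_del m B
    rw [show N + 1 - (a+1) = N - (a+1) + 1 by omega, Nat.choose_succ_succ', Nat.choose_succ_succ']
    omega

/-- Hilton-Milner for shifted families; `F` is `(a+1)`-uniform. -/
theorem hm_sh : ∀ N : ℕ, ∀ V : Finset ℕ, #V = N → ∀ a F, Unif V (a+1) F → Sh V F →
    Cross F F → (∀ x, ∃ S ∈ F, x ∉ S) → 2 * (a + 1) ≤ N →
    #F + (N - (a + 2)).choose a ≤ (N - 1).choose a + 1 := by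
  intro N
  induction N with
  | zero => intros; omega
  | succ N ih =>
    intro V hV a F hF sF hc nt ha
    rcases Nat.eq_or_lt_of_le ha with he | hlt
    · have := cross_base hF hF hc (by omega)
      rw [show N + 1 - (a + 2) = a by omega, Nat.choose_self, show N + 1 - 1 = 2 * a + 1 by omega]
      have e : (2 * (a+1)).choose (a+1) = (2 * a + 1).choose a + (2 * a + 1).choose (a + 1) := by
        rw [show 2 * (a+1) = 2 * a + 1 + 1 by ring, Nat.choose_succ_succ']
      have e2 : (2 * a + 1).choose (a + 1) = (2 * a + 1).choose a := by
        exact Nat.choose_symm_of_eq_add (by omega)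
      omega
    · have hVne : V.Nonempty := card_pos.1 (by omega)
      set m := V.max' hVne with hm
      have hmV : m ∈ V := max'_mem _ _
      have hle : ∀ x ∈ V, x ≤ m := fun x hx => le_max' _ _ hx
      have hVc : #(V.erase m) = N := by rw [card_erase_of_mem hmV]; omega
      have ndel : ∀ x, ∃ S ∈ del m F, x ∉ S := by
        intro x
        obtain ⟨S, hS, hx⟩ := nt x
        obtain ⟨S', h1, h2, h3⟩ := repl hle hmV sF hS (X := {x}) (by simpa using hx) (by
          rw [(hF S hS).2]; simp; omega)
        exact ⟨S', mem_del.2 ⟨h1, h2⟩, by simpa using h3⟩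
      have hdel := ih _ hVc a _ hF.del sF.del hc.del ndel (by omega)
      have lc := link_cross hle hmV sF hF hF hc (by omega)
      have e1 := card_link_del m F
      rcases a with _ | a
      · have : link m F = ∅ := by
          by_contra h
          obtain ⟨S, hS⟩ := nonempty_iff_ne_empty.2 h
          obtain ⟨x, hx, -⟩ := lc S hS S hS
          have := (hF.link S hS).2
          have := card_pos.2 ⟨x, hx⟩
          omega
        rw [this] at e1
        simp at *; omega
      have hlink : #(link m F) + (N - (a + 3)).choose a ≤ (N - 1).choose a := by
        by_cases nt' : ∀ x, ∃ S ∈ link m F, x ∉ S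
        · have := ih _ hVc a _ hF.link sF.link lc nt' (by omega)
          rcases a with _ | a
          · obtain ⟨S, hS, -⟩ := nt' 0
            have h1 := (hF.link S hS).2
            obtain ⟨x, hx⟩ := card_eq_one.1 h1
            obtain ⟨T, hT, hxT⟩ := nt' x
            obtain ⟨y, hy, hy'⟩ := lc S hS T hT
            rw [hx, mem_singleton] at hy
            subst hy; exact absurd hy' hxT
          · rw [show N - (a + 1 + 2) = (N - (a + 1 + 3)) + 1 by omega, Nat.choose_succ_succ'] at this
            have := Nat.choose_pos (n := N - (a+1+3)) (k := a) (by omega)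
            omega
        · push Not at nt'
          obtain ⟨x, hx⟩ := nt'
          rcases (link m F).eq_empty_or_nonempty with h0 | ⟨S0, hS0⟩
          · rw [h0]; simp; exact Nat.choose_le_choose _ (by omega)
          have hxV : x ∈ V.erase m := (hF.link S0 hS0).1 (hx S0 hS0)
          have hcl : #(link x (link m F)) = #(link m F) := by
            have := card_link_del x (link m F)
            have h0 : del x (link m F) = ∅ := by
              ext S; simp only [mem_del, notMem_empty, iff_false]; rintro ⟨h, h'⟩; exact h' (hx S h)
            rw [h0] at this; simpa using this
          obtain ⟨S, hS, hxS⟩ := ndel x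
          have hS' := hF.del S hS
          have := card_meet (hF.link (m := m)).link (W := (V.erase m).erase x) (G := S) (fun y hy => mem_erase.2 ⟨by
            rintro rfl; exact hxS hy, hS'.1 hy⟩) (fun T hT hd => by
            rw [mem_link] at hT
            refine link_meets hc hT.2 (mem_del.1 hS).1 (mem_del.1 hS).2 ?_
            rw [disjoint_insert_left]; exact ⟨hxS, hd⟩)
          rw [card_erase_of_mem hxV, hVc, hS'.2, hcl, show N - 1 - (a + 1 + 1) = N - (a + 3) by omega] at this
          exact this
      rw [show N + 1 - (a + 1 + 2) = (N - (a + 3)) + 1 by omega, show N + 1 - 1 = (N - 1) + 1 by omega,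
        Nat.choose_succ_succ', Nat.choose_succ_succ']
      rw [show N - (a + 1 + 2) = N - (a + 3) by omega] at hdel
      omega

/-- strict version, cover number at least 3 -/
theorem hm_sh' (V : Finset ℕ) (N a : ℕ) (F) (hV : #V = N + 1) (hF : Unif V (a+2) F) (sF : Sh V F)
    (hc : Cross F F) (nt : ∀ x y, ∃ S ∈ F, x ∉ S ∧ y ∉ S) (ha1 : 1 ≤ a) (ha : 2 * (a + 2) ≤ N) :
    #F + (N + 1 - (a + 3)).choose (a + 1) ≤ N.choose (a + 1) := by
  have hVne : V.Nonempty := card_pos.1 (by omega)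
  set m := V.max' hVne with hm
  have hmV : m ∈ V := max'_mem _ _
  have hle : ∀ x ∈ V, x ≤ m := fun x hx => le_max' _ _ hx
  have hVc : #(V.erase m) = N := by rw [card_erase_of_mem hmV]; omega
  have ndel : ∀ x y, ∃ S ∈ del m F, x ∉ S ∧ y ∉ S := by
    intro x y
    obtain ⟨S, hS, hx⟩ := nt x y
    obtain ⟨S', h1, h2, h3⟩ := repl hle hmV sF hS (X := {x, y}) (by simpa using hx) (by
      rw [(hF S hS).2]; have := card_le_two (a := x) (b := y); omega)
    exact ⟨S', mem_del.2 ⟨h1, h2⟩, by simpa using h3⟩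
  have hdel := hm_sh N _ hVc (a+1) _ hF.del sF.del hc.del (fun x => by
    obtain ⟨S, h1, h2, -⟩ := ndel x x
    exact ⟨S, h1, h2⟩) (by omega)
  have lc := link_cross hle hmV sF hF hF hc (by omega)
  have e1 := card_link_del m F
  have hlink : #(link m F) + (N - (a + 3)).choose a + 1 ≤ (N - 1).choose a := by
    rcases (link m F).eq_empty_or_nonempty with h0 | ⟨S0, hS0⟩
    · rw [h0]
      obtain ⟨a, rfl⟩ : ∃ b, a = b + 1 := ⟨a - 1, by omega⟩
      obtain ⟨M, hM⟩ : ∃ M, N = M + 2 := ⟨N - 2, by omega⟩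
      subst hM
      rw [show M + 2 - 1 = M + 1 by omega, Nat.choose_succ_succ']
      have h1 : 1 ≤ M.choose a := Nat.choose_pos (by omega)
      have h2 : (M + 2 - (a + 1 + 3)).choose (a+1) ≤ M.choose (a+1) := Nat.choose_le_choose _ (by omega)
      rw [card_empty]; omega
    by_cases nt' : ∀ x, ∃ S ∈ link m F, x ∉ S
    · have := hm_sh N _ hVc a _ hF.link sF.link lc nt' (by omega)
      rcases Nat.lt_or_ge a 2 with h2 | h2
      · skip
        obtain rfl : a = 1 := by omega
        obtain ⟨p, q, hpq, rfl⟩ := card_eq_two.1 (hF.link S0 hS0).2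
        obtain ⟨S, hS, hp, hq⟩ := ndel p q
        exfalso
        refine link_meets hc hS0 (mem_del.1 hS).1 (mem_del.1 hS).2 ?_
        simp [hp, hq]
      · obtain ⟨a, rfl⟩ : ∃ b, a = b + 1 := ⟨a - 1, by omega⟩
        rw [show N - (a + 1 + 2) = (N - (a + 1 + 3)) + 1 by omega, Nat.choose_succ_succ'] at this
        have h2 : 2 ≤ (N - (a+1+3)).choose a := by
          calc 2 ≤ a + 1 := by omega
            _ = (a+1).choose a := by simp
            _ ≤ _ := Nat.choose_le_choose _ (by omega)
        omega
    · push Not at nt'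
      obtain ⟨x, hx⟩ := nt'
      have hxV : x ∈ V.erase m := (hF.link S0 hS0).1 (hx S0 hS0)
      have hcl : #(link x (link m F)) = #(link m F) := by
        have := card_link_del x (link m F)
        have h0 : del x (link m F) = ∅ := by
          ext S; simp only [mem_del, notMem_empty, iff_false]; rintro ⟨h, h'⟩; exact h' (hx S h)
        rw [h0] at this; simpa using this
      obtain ⟨S, hS, hxS, -⟩ := ndel x x
      have hS' := hF.del S hS
      obtain ⟨s, hs⟩ : S.Nonempty := card_pos.1 (by omega)
      obtain ⟨T, hT, hxT, hsT⟩ := ndel x s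
      have hT' := hF.del T hT
      have hTW : T ⊆ (V.erase m).erase x := fun y hy => mem_erase.2 ⟨by
        rintro rfl; exact hxT hy, hT'.1 hy⟩
      have hSW : S ⊆ (V.erase m).erase x := fun y hy => mem_erase.2 ⟨by
        rintro rfl; exact hxS hy, hS'.1 hy⟩
      obtain ⟨R, hR1, hR2, hR3⟩ := exists_subsuperset_card_eq (s := {s}) (t := ((V.erase m).erase x) \ T) (n := a)
        (by rw [singleton_subset_iff, mem_sdiff]; exact ⟨hSW hs, hsT⟩) (by simp; omega)
        (by rw [card_sdiff_of_subset hTW, hT'.2, card_erase_of_mem hxV]; omega)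
      have mt : ∀ S ∈ del m F, x ∉ S → ∀ T ∈ link x (link m F), ¬ Disjoint T S := fun S hS hxS T hT hd => by
        rw [mem_link] at hT
        refine link_meets hc hT.2 (mem_del.1 hS).1 (mem_del.1 hS).2 ?_
        rw [disjoint_insert_left]; exact ⟨hxS, hd⟩
      have := card_meet' (R := R) (hF.link (m := m)).link (W := (V.erase m).erase x) (G := S) hSW (mt S hS hxS)
        (hR2.trans sdiff_subset) hR3 (not_disjoint_iff.2 ⟨s, by simpa using hR1, hs⟩)
        (fun h => mt T hT hxT R h (disjoint_of_subset_left hR2 sdiff_disjoint))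
      rw [card_erase_of_mem hxV, hVc, hS'.2, hcl, show N - 1 - (a + 2) = N - (a + 3) by omega] at this
      exact this
  rw [show N + 1 - (a + 3) = (N - (a + 3)) + 1 by omega, Nat.choose_succ_succ']
  obtain ⟨M, rfl⟩ : ∃ M, N = M + 1 := ⟨N - 1, by omega⟩
  rw [Nat.choose_succ_succ']
  simp only [Nat.add_sub_cancel] at *
  rw [show a + 1 + 2 = a + 3 by omega] at hdel
  omega

def mv (i j : ℕ) (A : Finset (Finset ℕ)) (S : Finset ℕ) : Finset ℕ :=
  if j ∈ S ∧ i ∉ S ∧ insert i (S.erase j) ∉ A then insert i (S.erase j) else S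

def shf (i j : ℕ) (A : Finset (Finset ℕ)) : Finset (Finset ℕ) := A.image (mv i j A)

lemma back {i j : ℕ} {S : Finset ℕ} (hj : j ∈ S) (hi : i ∉ S) :
    insert j ((insert i (S.erase j)).erase i) = S := by
  rw [erase_insert (by simp [hi]), insert_erase hj]

lemma mv_inj {i j : ℕ} (A) : Set.InjOn (mv i j A) (A : Set (Finset ℕ)) := by
  intro S hS T hT h
  simp only [mem_coe] at hS hT
  unfold mv at h
  split_ifs at h with h1 h2 h2
  · rw [← back h1.1 h1.2.1, h, back h2.1 h2.2.1]
  · exact absurd (h ▸ hT) h1.2.2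
  · exact absurd (h ▸ hS) h2.2.2
  · exact h

lemma card_shf (i j : ℕ) (A) : #(shf i j A) = #A := card_image_of_injOn (mv_inj A)

lemma shf_cases {i j : ℕ} (hij : i ≠ j) {A} {T : Finset ℕ} (h : T ∈ shf i j A) :
    (T ∈ A ∧ (j ∈ T → i ∉ T → insert i (T.erase j) ∈ A)) ∨
    (i ∈ T ∧ j ∉ T ∧ insert j (T.erase i) ∈ A ∧ T ∉ A) := by
  unfold shf at h
  rw [mem_image] at h
  obtain ⟨S, hS, rfl⟩ := h
  unfold mv
  split_ifs with h1
  · right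
    rw [back h1.1 h1.2.1]
    simp [hS, h1.2.2, hij.symm]
  · left
    exact ⟨hS, fun a b => by by_contra h; exact h1 ⟨a, b, h⟩⟩

lemma shf_stay {i j : ℕ} {A} {T : Finset ℕ} (h : T ∈ A) (h' : j ∈ T → i ∉ T → insert i (T.erase j) ∈ A) :
    T ∈ shf i j A := by
  refine mem_image.2 ⟨T, h, ?_⟩
  unfold mv
  rw [if_neg]
  rintro ⟨a, b, c⟩; exact c (h' a b)

lemma shf_move {i j : ℕ} {A} {T : Finset ℕ} (h : T ∈ A) (hj : j ∈ T) (hi : i ∉ T) :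
    insert i (T.erase j) ∈ shf i j A := by
  by_cases h' : insert i (T.erase j) ∈ A
  · exact shf_stay h' (fun _ h => absurd (mem_insert_self _ _) h)
  · refine mem_image.2 ⟨T, h, ?_⟩
    unfold mv
    rw [if_pos ⟨hj, hi, h'⟩]

lemma Unif.shf {V : Finset ℕ} {a i j : ℕ} {A} (h : Unif V a A) (hi : i ∈ V) : Unif V a (shf i j A) := by
  intro S hS
  unfold HM.shf at hS
  rw [mem_image] at hS
  obtain ⟨T, hT, rfl⟩ := hS
  unfold mv
  split_ifs with h1
  · refine ⟨insert_subset hi ((erase_subset _ _).trans (h T hT).1), ?_⟩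
    rw [card_insert_of_notMem (by simp [h1.2.1]), card_erase_of_mem h1.1, (h T hT).2]
    have := card_pos.2 ⟨j, h1.1⟩
    have := (h T hT).2
    omega
  · exact h T hT

lemma Cross.shf {i j : ℕ} (hij : i ≠ j) {A B} (h : Cross A B) : Cross (shf i j A) (shf i j B) := by
  have key : ∀ {A B}, Cross A B → ∀ S T, (i ∈ S ∧ j ∉ S ∧ insert j (S.erase i) ∈ A ∧ S ∉ A) →
      (T ∈ B ∧ (j ∈ T → i ∉ T → insert i (T.erase j) ∈ B)) → ∃ x, x ∈ S ∧ x ∈ T := by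
    intro A B h S T h1 h2
    by_cases hiT : i ∈ T
    · exact ⟨i, h1.1, hiT⟩
    by_cases hjT : j ∈ T
    · obtain ⟨x, hx, hy⟩ := h _ h1.2.2.1 _ (h2.2 hjT hiT)
      simp only [mem_insert, mem_erase] at hx hy
      grind
    · obtain ⟨x, hx, hy⟩ := h _ h1.2.2.1 _ h2.1
      simp only [mem_insert, mem_erase] at hx
      grind
  intro S hS T hT
  rcases shf_cases hij hS with h1 | h1 <;> rcases shf_cases hij hT with h2 | h2
  · exact h _ h1.1 _ h2.1
  · obtain ⟨x, hx, hy⟩ := key h.symm _ _ h2 h1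
    exact ⟨x, hy, hx⟩
  · exact key h _ _ h1 h2
  · exact ⟨i, h1.1, h2.1⟩

def wt (A : Finset (Finset ℕ)) : ℕ := ∑ S ∈ A, ∑ x ∈ S, x

lemma wt_mv {i j : ℕ} (hij : i < j) {S : Finset ℕ} (hj : j ∈ S) (hi : i ∉ S) :
    ∑ x ∈ insert i (S.erase j), x < ∑ x ∈ S, x := by
  rw [sum_insert (by simp [hi])]
  have := sum_erase_add S (fun x => x) hj
  omega

lemma wt_le {i j : ℕ} (hij : i < j) (A) : wt (shf i j A) ≤ wt A := by
  unfold wt shf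
  rw [sum_image (mv_inj A)]
  apply sum_le_sum
  intro S hS
  unfold mv
  split_ifs with h
  · exact (wt_mv hij h.1 h.2.1).le
  · exact le_rfl

lemma wt_lt {i j : ℕ} (hij : i < j) {A} {S : Finset ℕ} (hS : S ∈ A) (hj : j ∈ S) (hi : i ∉ S)
    (hn : insert i (S.erase j) ∉ A) : wt (shf i j A) < wt A := by
  unfold wt shf
  rw [sum_image (mv_inj A)]
  apply sum_lt_sum
  · intro S hS
    unfold mv
    split_ifs with h
    · exact (wt_mv hij h.1 h.2.1).le
    · exact le_rfl
  · refine ⟨S, hS, ?_⟩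
    unfold mv
    rw [if_pos ⟨hj, hi, hn⟩]
    exact wt_mv hij hj hi

lemma not_sh {V : Finset ℕ} {A} (h : ¬ Sh V A) : ∃ i ∈ V, ∃ j ∈ V, i < j ∧ wt (shf i j A) < wt A := by
  unfold Sh at h
  push Not at h
  obtain ⟨i, hi, j, hj, hij, S, hS, h1, h2, h3⟩ := h
  exact ⟨i, hi, j, hj, hij, wt_lt hij hS h1 h2 h3⟩

lemma exists_sh {V : Finset ℕ} {a : ℕ} : ∀ w : ℕ, ∀ A B, wt A + wt B = w → Unif V a A → Unif V a B → Cross A B →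
    ∃ A' B', Unif V a A' ∧ Unif V a B' ∧ Cross A' B' ∧ Sh V A' ∧ Sh V B' ∧ #A' = #A ∧ #B' = #B := by
  intro w
  induction w using Nat.strong_induction_on with
  | _ w ih =>
    intro A B hw hA hB hc
    by_cases sA : Sh V A
    · by_cases sB : Sh V B
      · exact ⟨A, B, hA, hB, hc, sA, sB, rfl, rfl⟩
      · obtain ⟨i, hi, j, hj, hij, hlt⟩ := not_sh sB
        have := wt_le hij A
        obtain ⟨A', B', h⟩ := ih _ (by omega) (shf i j A) (shf i j B) rfl (hA.shf hi) (hB.shf hi) (hc.shf hij.ne)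
        rw [card_shf, card_shf] at h
        exact ⟨A', B', h⟩
    · obtain ⟨i, hi, j, hj, hij, hlt⟩ := not_sh sA
      have := wt_le hij B
      obtain ⟨A', B', h⟩ := ih _ (by omega) (shf i j A) (shf i j B) rfl (hA.shf hi) (hB.shf hi) (hc.shf hij.ne)
      rw [card_shf, card_shf] at h
      exact ⟨A', B', h⟩

theorem cross_weak {V : Finset ℕ} {a : ℕ} {A B} (hA : Unif V a A) (hB : Unif V a B) (hc : Cross A B)
    (neA : A.Nonempty) (neB : B.Nonempty) (hn : 2 * a ≤ #V) :
    #A + #B + (#V - a).choose a ≤ (#V).choose a + 1 := by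
  obtain ⟨A', B', hA', hB', hc', sA, sB, e1, e2⟩ := exists_sh _ A B rfl hA hB hc
  rw [← e1, ← e2]
  exact cross_sh _ V rfl a A' B' hA' hB' sA sB hc' (card_pos.1 (e1 ▸ card_pos.2 neA))
    (card_pos.1 (e2 ▸ card_pos.2 neB)) hn

theorem cross_strict {V : Finset ℕ} {a : ℕ} {A B} (hA : Unif V a A) (hB : Unif V a B) (hc : Cross A B)
    (neA : 2 ≤ #A) (neB : 2 ≤ #B) (ha : 3 ≤ a) (hn : 2 * a + 1 ≤ #V) :
    #A + #B + (#V - a).choose a ≤ (#V).choose a := by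
  obtain ⟨A', B', hA', hB', hc', sA, sB, e1, e2⟩ := exists_sh _ A B rfl hA hB hc
  rw [← e1, ← e2]
  exact cross_sh' _ V rfl a A' B' hA' hB' sA sB hc' (by omega) (by omega) ha hn

lemma pair_eq {T : Finset ℕ} {x y : ℕ} (h : #T = 2) (hx : x ∈ T) (hy : y ∈ T) (hxy : x ≠ y) : T = {x, y} := by
  symm
  apply eq_of_subset_of_card_le
  · intro z hz; simp at hz; rcases hz with rfl | rfl <;> assumption
  · rw [h, card_pair hxy]

lemma star_card {V : Finset ℕ} {A} (hA : Unif V 2 A) {z : ℕ} (hz : z ∈ V) (h : ∀ S ∈ A, z ∈ S) : #A ≤ #V - 1 := by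
  have h1 := card_all (hA.link (m := z))
  have h2 := card_link_del z A
  have h0 : del z A = ∅ := by
    ext S; simp only [mem_del, notMem_empty, iff_false]; rintro ⟨hh, h'⟩; exact h' (h S hh)
  rw [h0, card_empty] at h2
  rw [card_erase_of_mem hz, Nat.choose_one_right] at h1
  omega

lemma cross2_star {V : Finset ℕ} {A B} (hA : Unif V 2 A) (hB : Unif V 2 B) (hc : Cross A B)
    (neA : 2 ≤ #A) (hn : 5 ≤ #V) {z : ℕ} (hz : ∀ S ∈ A, z ∈ S) :
    #A + #B ≤ 2 * #V - 3 ∨ ∃ z ∈ V, (∀ S ∈ A, z ∈ S) ∧ (∀ S ∈ B, z ∈ S) ∧ #A = #V - 1 ∧ #B = #V - 1 := by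
  obtain ⟨S, T, hS, hT, hST⟩ := one_lt_card_iff.1 neA
  have hzV : z ∈ V := (hA S hS).1 (hz S hS)
  have cA := star_card hA hzV hz
  by_cases hB' : ∀ T ∈ B, z ∈ T
  · have cB := star_card hB hzV hB'
    by_cases h : #A + #B ≤ 2 * #V - 3
    · exact Or.inl h
    · exact Or.inr ⟨z, hzV, hz, hB', by omega, by omega⟩
  · left
    push Not at hB'
    obtain ⟨g, hg, hzg⟩ := hB'
    have hA2 : A ⊆ g.image (fun p => {z, p}) := by
      intro U hU
      obtain ⟨x, hx, hy⟩ := hc U hU g hg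
      refine mem_image.2 ⟨x, hy, (pair_eq (hA U hU).2 (hz U hU) hx ?_).symm⟩
      rintro rfl; exact hzg hy
    have h2 : #A ≤ 2 := (card_le_card hA2).trans (card_image_le.trans (hB g hg).2.le)
    have hB1 : ∀ U ∈ B, z ∉ U → U = g := by
      intro U hU hzU
      obtain ⟨p, hp, hp'⟩ := hc S hS U hU
      obtain ⟨q, hq, hq'⟩ := hc T hT U hU
      obtain ⟨p1, hp1, hp1'⟩ := hc S hS g hg
      obtain ⟨q1, hq1, hq1'⟩ := hc T hT g hg
      have e1 := pair_eq (hA S hS).2 (hz S hS) hp (by rintro rfl; exact hzU hp')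
      have e2 := pair_eq (hA T hT).2 (hz T hT) hq (by rintro rfl; exact hzU hq')
      have : p ≠ q := by rintro rfl; exact hST (e1.trans e2.symm)
      have : p1 = p := by
        rw [e1] at hp1; simp at hp1; rcases hp1 with rfl | h; exact absurd hp1' hzg; exact h
      have : q1 = q := by
        rw [e2] at hq1; simp at hq1; rcases hq1 with rfl | h; exact absurd hq1' hzg; exact h
      subst p1 q1
      rw [pair_eq (hB U hU).2 hp' hq' (by assumption), pair_eq (hB g hg).2 hp1' hq1' (by assumption)]
    have h3 : #(B.erase g) ≤ #V - 1 := by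
      refine star_card (z := z) (fun U hU => hB U (mem_of_mem_erase hU)) hzV ?_
      intro U hU
      by_contra h
      exact (mem_erase.1 hU).1 (hB1 U (mem_of_mem_erase hU) h)
    rw [card_erase_of_mem hg] at h3
    omega

lemma cross2_nc {V : Finset ℕ} {A B} (hA : Unif V 2 A) (hB : Unif V 2 B) (hc : Cross A B)
    (neA : A.Nonempty) (nA : ∀ z, ∃ S ∈ A, z ∉ S) : #B ≤ 3 ∨ (#B ≤ 4 ∧ #A ≤ 3) := by
  by_cases hd : ∃ S ∈ A, ∃ T ∈ A, Disjoint S T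
  · obtain ⟨S, hS, T, hT, hST⟩ := hd
    obtain ⟨p, q, hpq, rfl⟩ := card_eq_two.1 (hA S hS).2
    obtain ⟨r, s, hrs, rfl⟩ := card_eq_two.1 (hA T hT).2
    simp at hST
    have hB4 : B ⊆ {{p,r},{p,s},{q,r},{q,s}} := by
      intro U hU
      obtain ⟨x, hx, hx'⟩ := hc _ hS U hU
      obtain ⟨y, hy, hy'⟩ := hc _ hT U hU
      have := pair_eq (hB U hU).2 hx' hy' (by rintro rfl; simp at hx hy; grind)
      simp only [mem_insert, mem_singleton] at hx hy ⊢
      rcases hx with rfl | rfl <;> rcases hy with rfl | rfl <;> simp [this]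
    have h4 : #({{p,r},{p,s},{q,r},{q,s}} : Finset (Finset ℕ)) ≤ 4 := card_le_four
    have hB4' := card_le_card hB4
    by_cases h : #B ≤ 3
    · exact Or.inl h
    right
    refine ⟨by omega, ?_⟩
    have hBe := eq_of_subset_of_card_le hB4 (by omega)
    have hA2 : A ⊆ {{p,q},{r,s}} := by
      intro U hU
      obtain ⟨x1, h1, h1'⟩ := hc U hU {p,r} (by rw [hBe]; simp)
      obtain ⟨x2, h2, h2'⟩ := hc U hU {p,s} (by rw [hBe]; simp)
      obtain ⟨x3, h3, h3'⟩ := hc U hU {q,r} (by rw [hBe]; simp)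
      obtain ⟨x4, h4, h4'⟩ := hc U hU {q,s} (by rw [hBe]; simp)
      have hU2 := (hA U hU).2
      simp only [mem_insert, mem_singleton] at *
      by_cases hp : p ∈ U
      · by_cases hq : q ∈ U
        · left; exact pair_eq hU2 hp hq hpq
        · have hr : r ∈ U := by grind
          have hs : s ∈ U := by grind
          right; exact pair_eq hU2 hr hs hrs
      · have hr : r ∈ U := by grind
        have hs : s ∈ U := by grind
        right; exact pair_eq hU2 hr hs hrs
    have := (card_le_card hA2).trans card_le_two
    omega
  · left
    push Not at hd
    obtain ⟨S, hS⟩ := neA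
    obtain ⟨p, q, hpq, rfl⟩ := card_eq_two.1 (hA S hS).2
    obtain ⟨T, hT, hpT⟩ := nA p
    obtain ⟨U, hU, hqU⟩ := nA q
    obtain ⟨x, hx, hx'⟩ := not_disjoint_iff.1 (hd _ hS _ hT)
    obtain ⟨y, hy, hy'⟩ := not_disjoint_iff.1 (hd _ hS _ hU)
    obtain ⟨s, hs, hs'⟩ := not_disjoint_iff.1 (hd _ hT _ hU)
    have hxq : x = q := by simp at hx; grind
    have hyp : y = p := by simp at hy; grind
    subst hxq hyp
    have eT := pair_eq (hA T hT).2 hx' hs (by rintro rfl; exact hqU hs')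
    have eU := pair_eq (hA U hU).2 hy' hs' (by rintro rfl; exact hpT hs)
    subst eT eU
    have hB3 : B ⊆ {{y,x},{y,s},{x,s}} := by
      intro W hW
      obtain ⟨x1, h1, h1'⟩ := hc _ hS _ hW
      obtain ⟨x2, h2, h2'⟩ := hc _ hT _ hW
      obtain ⟨x3, h3, h3'⟩ := hc _ hU _ hW
      have hW2 := (hB W hW).2
      simp only [mem_insert, mem_singleton] at *
      by_cases hp : y ∈ W
      · by_cases hq : x ∈ W
        · left; exact pair_eq hW2 hp hq hpq
        · right; left; exact pair_eq hW2 hp (by grind) (by grind)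
      · right; right; exact pair_eq hW2 (x := x) (y := s) (by grind) (by grind) (by grind)
    exact (card_le_card hB3).trans card_le_three

theorem cross2 {V : Finset ℕ} {A B} (hA : Unif V 2 A) (hB : Unif V 2 B) (hc : Cross A B)
    (neA : 2 ≤ #A) (neB : 2 ≤ #B) (hn : 5 ≤ #V) :
    #A + #B ≤ 2 * #V - 3 ∨ ∃ z ∈ V, (∀ S ∈ A, z ∈ S) ∧ (∀ S ∈ B, z ∈ S) ∧ #A = #V - 1 ∧ #B = #V - 1 := by
  by_cases h1 : ∃ z, ∀ S ∈ A, z ∈ S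
  · obtain ⟨z, hz⟩ := h1
    exact cross2_star hA hB hc neA hn hz
  by_cases h2 : ∃ z, ∀ S ∈ B, z ∈ S
  · obtain ⟨z, hz⟩ := h2
    rcases cross2_star hB hA hc.symm neB hn hz with h | ⟨z, a, b, c, d, e⟩
    · left; omega
    · exact Or.inr ⟨z, a, c, b, e, d⟩
  push Not at h1 h2
  left
  have := cross2_nc hA hB hc (card_pos.1 (by omega)) h1
  have := cross2_nc hB hA hc.symm (card_pos.1 (by omega)) h2
  omega

/-- combined statement -/
theorem cross_eq {V : Finset ℕ} {a : ℕ} {A B} (hA : Unif V a A) (hB : Unif V a B) (hc : Cross A B)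
    (neA : A.Nonempty) (neB : B.Nonempty) (ha : 2 ≤ a) (hn : 2 * a + 1 ≤ #V) :
    #A + #B + (#V - a).choose a ≤ (#V).choose a ∨ #A = 1 ∨ #B = 1 ∨
    (a = 2 ∧ ∃ z ∈ V, (∀ S ∈ A, z ∈ S) ∧ (∀ S ∈ B, z ∈ S) ∧ #A = #V - 1 ∧ #B = #V - 1) := by
  have := card_pos.2 neA
  have := card_pos.2 neB
  by_cases h1 : #A = 1
  · exact Or.inr (Or.inl h1)
  by_cases h2 : #B = 1
  · exact Or.inr (Or.inr (Or.inl h2))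
  rcases Nat.eq_or_lt_of_le ha with rfl | h3
  · rcases cross2 hA hB hc (by omega) (by omega) (by omega) with h | h
    · left
      obtain ⟨M, hM⟩ : ∃ M, #V = M + 2 := ⟨#V - 2, by omega⟩
      rw [hM] at h ⊢
      have e1 := Nat.choose_succ_succ' (M+1) 1
      have e2 := Nat.choose_succ_succ' M 1
      simp only [Nat.choose_one_right, Nat.reduceAdd, add_assoc] at e1 e2
      rw [show M + 2 - 2 = M by omega]
      omega
    · exact Or.inr (Or.inr (Or.inr ⟨rfl, h⟩))
  · exact Or.inl (cross_strict hA hB hc (by omega) (by omega) h3 hn)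

lemma link_del_comm {x y : ℕ} (hxy : x ≠ y) (F) : del x (link y F) = link y (del x F) := by
  ext S
  simp only [mem_del, mem_link, mem_insert, not_or]
  tauto

lemma split4 {x y : ℕ} (hxy : x ≠ y) (F) :
    #F = #(link x (link y F)) + #(link x (del y F)) + #(link y (del x F)) + #(del x (del y F)) := by
  rw [← link_del_comm hxy]
  have h1 := card_link_del y F
  have h2 := card_link_del x (link y F)
  have h3 := card_link_del x (del y F)
  omega

lemma cross_AB {x y : ℕ} {F} (hc : Cross F F) : Cross (link x (del y F)) (link y (del x F)) := by
  intro S hS T hT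
  simp only [mem_link, mem_del, mem_insert, not_or] at hS hT
  obtain ⟨w, hw, hw'⟩ := hc _ hS.2.1 _ hT.2.1
  simp only [mem_insert] at hw hw'
  grind

lemma Unif.A {V : Finset ℕ} {a x y : ℕ} {F} (h : Unif V (a+1) F) :
    Unif ((V.erase y).erase x) a (HM.link x (HM.del y F)) := h.del.link

lemma Unif.B {V : Finset ℕ} {a x y : ℕ} {F} (h : Unif V (a+1) F) :
    Unif ((V.erase y).erase x) a (HM.link y (HM.del x F)) := by
  rw [erase_right_comm]; exact h.del.link

lemma card_W {V : Finset ℕ} {x y : ℕ} (hx : x ∈ V) (hy : y ∈ V) (hxy : x ≠ y) :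
    #((V.erase y).erase x) = #V - 2 := by
  rw [card_erase_of_mem (mem_erase.2 ⟨hxy, hx⟩), card_erase_of_mem hy]; omega

lemma del_del_empty {x y : ℕ} {F} (h : ∀ S ∈ F, x ∈ S ∨ y ∈ S) : del x (del y F) = ∅ := by
  ext S; simp only [mem_del, notMem_empty, iff_false]
  rintro ⟨⟨h1, h2⟩, h3⟩
  rcases h S h1 with h | h <;> contradiction

lemma pascal {n c : ℕ} (hn : 2 ≤ n) : (n - 1).choose (c + 1) = (n - 2).choose c + (n - 2).choose (c + 1) := by
  obtain ⟨m, rfl⟩ : ∃ m, n = m + 2 := ⟨n - 2, by omega⟩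
  exact Nat.choose_succ_succ' m c

theorem hm3 {V : Finset ℕ} {c : ℕ} (hc1 : 1 ≤ c) (hn : 2 * c + 5 ≤ #V) : ∀ w : ℕ, ∀ F, wt F = w →
    Unif V (c+2) F → Cross F F → (∀ x y, ∃ S ∈ F, x ∉ S ∧ y ∉ S) →
    #F + (#V - (c + 3)).choose (c + 1) ≤ (#V - 1).choose (c + 1) := by
  intro w
  induction w using Nat.strong_induction_on with
  | _ w ih =>
    intro F hw hF hc nt
    by_cases sF : Sh V F
    · obtain ⟨N, hN⟩ : ∃ N, #V = N + 1 := ⟨#V - 1, by omega⟩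
      have := hm_sh' V N c F hN hF sF hc nt hc1 (by omega)
      rw [hN]; exact this
    obtain ⟨i, hi, j, hj, hij, hlt⟩ := not_sh sF
    have hij' := hij.ne
    by_cases nt' : ∀ x y, ∃ S ∈ shf i j F, x ∉ S ∧ y ∉ S
    · have := ih _ (by omega) (shf i j F) rfl (hF.shf hi) (hc.shf hij') nt'
      rwa [card_shf] at this
    push Not at nt'
    have hv : ∃ v, ∀ S ∈ shf i j F, i ∈ S ∨ v ∈ S := by
      obtain ⟨u, v, h⟩ := nt'
      by_cases hu : u = i
      · subst hu; exact ⟨v, fun S hS => by have := h S hS; tauto⟩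
      by_cases hv : v = i
      · subst hv; exact ⟨u, fun S hS => by have := h S hS; tauto⟩
      exfalso
      obtain ⟨S, hS, hS1, hS2⟩ := nt u v
      by_cases hh : j ∈ S ∧ i ∉ S
      · have h1 := h _ (shf_move hS hh.1 hh.2)
        simp [hu, hv, hS1, hS2] at h1
      · exact hS2 (h S (shf_stay hS (fun a b => absurd ⟨a, b⟩ hh)) hS1)
    obtain ⟨v, hv⟩ := hv
    obtain ⟨S0, hS0, hS0i, hS0j⟩ := nt i j
    have hS0' : S0 ∈ shf i j F := shf_stay hS0 (fun h => absurd h hS0j)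
    have hvS0 : v ∈ S0 := (hv S0 hS0').resolve_left hS0i
    have hvV : v ∈ V := (hF S0 hS0).1 hvS0
    have hvi : v ≠ i := by rintro rfl; exact hS0i hvS0
    have hvj : v ≠ j := by rintro rfl; exact hS0j hvS0
    obtain ⟨S1, hS1, hS1v, hS1j⟩ := nt v j
    have hS1' : S1 ∈ shf i j F := shf_stay hS1 (fun h => absurd h hS1j)
    have hiS1 : i ∈ S1 := (hv S1 hS1').resolve_right hS1v
    obtain ⟨S2, hS2, hS2i, hS2v⟩ := nt i v
    have hS2' : S2 ∉ shf i j F := fun h => (hv S2 h).elim hS2i hS2v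
    have hjS2 : j ∈ S2 := by
      by_contra h; exact hS2' (shf_stay hS2 (fun h' => absurd h' h))
    have hS2m : insert i (S2.erase j) ∉ F := fun h => hS2' (shf_stay hS2 (fun _ _ => h))
    have hS2s := shf_move hS2 hjS2 hS2i
    have uF' : Unif V (c+2) (shf i j F) := hF.shf hi
    have cF' := hc.shf hij'
    have hW := card_W hi hvV hvi.symm
    have mA : ∀ S ∈ shf i j F, i ∈ S → v ∉ S → S.erase i ∈ link i (del v (shf i j F)) := by
      intro S hS h1 h2
      rw [mem_link, mem_del, insert_erase h1]
      exact ⟨notMem_erase _ _, hS, h2⟩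
    have mB : ∀ S ∈ shf i j F, v ∈ S → i ∉ S → S.erase v ∈ link v (del i (shf i j F)) := by
      intro S hS h1 h2
      rw [mem_link, mem_del, insert_erase h1]
      exact ⟨notMem_erase _ _, hS, h2⟩
    have m1 := mA S1 hS1' hiS1 hS1v
    have m0 := mB S0 hS0' hvS0 hS0i
    have m2 : S2.erase j ∈ link i (del v (shf i j F)) := by
      have := mA _ hS2s (mem_insert_self _ _) (by simp [hvi, hS2v])
      rwa [erase_insert (by simp [hS2i])] at this
    have hsp := split4 hvi.symm (shf i j F)
    rw [del_del_empty hv, card_empty, card_shf] at hsp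
    have hL := card_all (uF'.link (m := v)).link (W := (V.erase v).erase i)
    have hpas := pascal (n := #V) (c := c) (by omega)
    rcases cross_eq (V := (V.erase v).erase i) uF'.A uF'.B (cross_AB cF') ⟨_, m1⟩ ⟨_, m0⟩ (by omega) (by omega) with h | h | h | ⟨h2, z, hz, hzA, hzB, cA, cB⟩
    · rw [hW] at h hL
      rw [show #V - 2 - (c + 1) = #V - (c + 3) by omega] at h
      omega
    · exfalso
      have := card_le_one.1 h.le _ m1 _ m2
      apply hS2m
      rw [← this, insert_erase hiS1]; exact hS1
    · have hsp' := split4 hij' F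
      have hW' := card_W hi hj hij'
      have hd : #(del i (del j F)) ≤ 1 := by
        rw [card_le_one]
        intro S hS T hT
        simp only [mem_del] at hS hT
        have s1 : S ∈ shf i j F := shf_stay hS.1.1 (fun h => absurd h hS.1.2)
        have t1 : T ∈ shf i j F := shf_stay hT.1.1 (fun h => absurd h hT.1.2)
        have s2 := (hv S s1).resolve_left hS.2
        have t2 := (hv T t1).resolve_left hT.2
        have := card_le_one.1 h.le _ (mB S s1 s2 hS.2) _ (mB T t1 t2 hT.2)
        rw [← insert_erase s2, this, insert_erase t2]
      have hL' := card_meet (hF.link (m := j)).link (W := (V.erase j).erase i) (G := S0) (fun y hy => by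
        simp only [mem_erase]
        exact ⟨by rintro rfl; exact hS0i hy, by rintro rfl; exact hS0j hy, (hF S0 hS0).1 hy⟩) (fun T hT hd => by
          simp only [mem_link] at hT
          obtain ⟨x, hx, hx'⟩ := hc _ hT.2.2 _ hS0
          simp only [mem_insert] at hx
          rcases hx with rfl | rfl | hx
          · exact hS0j hx'
          · exact hS0i hx'
          · exact disjoint_left.1 hd hx hx')
      have hAB := cross_weak (V := (V.erase j).erase i) hF.A hF.B (cross_AB hc (x := i) (y := j)) ⟨S1.erase i, by
        rw [mem_link, mem_del, insert_erase hiS1]; exact ⟨notMem_erase _ _, hS1, hS1j⟩⟩ ⟨S2.erase j, by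
        rw [mem_link, mem_del, insert_erase hjS2]; exact ⟨notMem_erase _ _, hS2, hS2i⟩⟩ (by omega)
      rw [hW'] at hL' hAB
      rw [(hF S0 hS0).2] at hL'
      have h2 : 2 ≤ (#V - 2 - (c + 2)).choose c := by
        calc 2 ≤ c + 1 := by omega
          _ = (c+1).choose c := by simp
          _ ≤ _ := Nat.choose_le_choose _ (by omega)
      rw [show #V - 2 - (c + 1) = #V - (c + 3) by omega] at hAB
      omega
    · exfalso
      obtain rfl : c = 1 := by omega
      have z2 := hzA _ m2
      have hzj : z ≠ j := (mem_erase.1 z2).1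
      simp only [mem_erase] at hz
      obtain ⟨T2, hT2, hT2i, hT2z⟩ := nt i z
      have hjT2 : j ∈ T2 := by
        by_contra h
        have h' : T2 ∈ shf i j F := shf_stay hT2 (fun h' => absurd h' h)
        exact hT2z (mem_of_mem_erase (hzB _ (mB T2 h' ((hv T2 h').resolve_left hT2i) hT2i)))
      have hvT2 : v ∈ T2 := by
        by_contra h
        have h' := mA _ (shf_move hT2 hjT2 hT2i) (mem_insert_self _ _) (by simp [hvi, h])
        rw [erase_insert (by simp [hT2i])] at h'
        exact hT2z (mem_of_mem_erase (hzA _ h'))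
      obtain ⟨T1, hT1, hT1j, hT1z⟩ := nt j z
      have hT1' : T1 ∈ shf i j F := shf_stay hT1 (fun h' => absurd h' hT1j)
      have hiT1 : i ∈ T1 := by
        by_contra h
        exact hT1z (mem_of_mem_erase (hzB _ (mB T1 hT1' ((hv T1 hT1').resolve_left h) h)))
      have hvT1 : v ∈ T1 := by
        by_contra h
        exact hT1z (mem_of_mem_erase (hzA _ (mA T1 hT1' hiT1 h)))
      have : ∃ w ∈ V, w ∉ insert z (T1 ∪ T2) := by
        by_contra! hh
        have := card_le_card (show V ⊆ insert z (T1 ∪ T2) from hh)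
        have h2 := card_union_add_card_inter T1 T2
        have h3 := card_insert_le z (T1 ∪ T2)
        have h4 : 0 < #(T1 ∩ T2) := card_pos.2 ⟨v, mem_inter.2 ⟨hvT1, hvT2⟩⟩
        rw [(hF T1 hT1).2, (hF T2 hT2).2] at h2
        omega
      obtain ⟨w, hwV, hw⟩ := this
      simp only [mem_insert, mem_union, not_or] at hw
      have hwi : w ≠ i := by rintro rfl; exact hw.2.1 hiT1
      have hwj : w ≠ j := by rintro rfl; exact hw.2.2 hjT2
      have hwv : w ≠ v := by rintro rfl; exact hw.2.1 hvT1
      have uA : Unif ((V.erase v).erase i) (1+1) (link i (del v (shf i j F))) := uF'.A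
      have full : {w} ∈ link z (link i (del v (shf i j F))) := by
        have hl := card_link_del z (link i (del v (shf i j F)))
        have h0 : del z (link i (del v (shf i j F))) = ∅ := by
          ext S; simp only [mem_del, notMem_empty, iff_false]; rintro ⟨hh, h'⟩; exact h' (hzA S hh)
        rw [h0, card_empty] at hl
        have hu := (uA.link (m := z)).sub
        have := eq_of_subset_of_card_le hu (by
          rw [card_powersetCard, Nat.choose_one_right, card_erase_of_mem (by simp [hz])]; omega)
        rw [this, mem_powersetCard]
        simp [hw.1, hwi, hwv, hwV]
      simp only [mem_link, mem_del] at full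
      have hm := full.2.2.1
      rcases shf_cases hij' hm with h | h
      · obtain ⟨x, hx, hx'⟩ := hc _ h.1 _ hT2
        simp only [mem_insert, mem_singleton] at hx
        rcases hx with rfl | rfl | rfl
        · exact hT2i hx'
        · exact hT2z hx'
        · exact hw.2.2 hx'
      · obtain ⟨x, hx, hx'⟩ := hc _ h.2.2.1 _ hT1
        simp only [mem_insert, mem_singleton, mem_erase] at hx
        rcases hx with rfl | ⟨hxi, rfl | rfl | rfl⟩
        · exact hT1j hx'
        · exact hxi rfl
        · exact hT1z hx'
        · exact hw.2.1 hx'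

def NC (m r : ℕ) : Finset (Finset ℕ) := {S ∈ (range m).powersetCard r | ∀ i ∈ S, i + 1 ∉ S}

lemma mem_NC {m r : ℕ} {S} : S ∈ NC m r ↔ (S ⊆ range m ∧ #S = r) ∧ ∀ i ∈ S, i + 1 ∉ S := by
  simp [NC, mem_powersetCard]

lemma NC_zero (m : ℕ) : #(NC m 0) = 1 := by
  have : NC m 0 = {∅} := by
    ext S
    rw [mem_NC, mem_singleton]
    constructor
    · intro h; exact card_eq_zero.1 h.1.2
    · rintro rfl; simp
  rw [this, card_singleton]

lemma NC_rec (m r : ℕ) : #(NC (m+2) (r+1)) = #(NC (m+1) (r+1)) + #(NC m r) := by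
  rw [← card_link_del (m+1) (NC (m+2) (r+1)), add_comm]
  congr 2
  · ext S
    simp only [mem_del, mem_NC]
    constructor
    · rintro ⟨⟨⟨h1, h2⟩, h3⟩, h4⟩
      refine ⟨⟨fun x hx => ?_, h2⟩, h3⟩
      have := h1 hx
      have : x ≠ m + 1 := by rintro rfl; exact h4 hx
      simp at *; omega
    · rintro ⟨⟨h1, h2⟩, h3⟩
      refine ⟨⟨⟨fun x hx => ?_, h2⟩, h3⟩, fun h => ?_⟩
      · have := h1 hx; simp at *; omega
      · have := h1 h; simp at this
  · ext S
    simp only [mem_link, mem_NC]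
    constructor
    · rintro ⟨h0, ⟨h1, h2⟩, h3⟩
      rw [card_insert_of_notMem h0] at h2
      refine ⟨⟨fun x hx => ?_, by omega⟩, fun i hi hi' => h3 i (mem_insert_of_mem hi) (mem_insert_of_mem hi')⟩
      have := h1 (mem_insert_of_mem hx)
      have h5 : x ≠ m + 1 := by rintro rfl; exact h0 hx
      have h6 : x ≠ m := by rintro rfl; exact h3 x (mem_insert_of_mem hx) (mem_insert_self _ _)
      simp at *; omega
    · rintro ⟨⟨h1, h2⟩, h3⟩
      have h1' : ∀ x ∈ S, x < m := fun x hx => by simpa using h1 hx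
      have h0 : m + 1 ∉ S := fun h => by have := h1' _ h; omega
      refine ⟨h0, ⟨?_, by rw [card_insert_of_notMem h0]; omega⟩, ?_⟩
      · intro x hx
        simp only [mem_insert, mem_range] at *
        rcases hx with rfl | hx
        · omega
        · have := h1' x hx; omega
      · intro i hi hi'
        simp only [mem_insert] at *
        rcases hi with rfl | hi <;> rcases hi' with h | hi'
        · omega
        · have := h1' _ hi'; omega
        · have := h1' _ hi; omega
        · exact h3 i hi hi'

lemma card_NC : ∀ m r : ℕ, #(NC m r) = (m + 1 - r).choose r := by
  intro m
  induction m using Nat.strong_induction_on with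
  | _ m ih =>
    intro r
    rcases r with _ | r
    · rw [NC_zero]; simp
    rcases m with _ | _ | m
    · have : NC 0 (r+1) = ∅ := by
        ext S; rw [mem_NC]; simp only [notMem_empty, iff_false]
        rintro ⟨⟨h1, h2⟩, -⟩
        have := card_le_card h1
        simp at this; subst this; simp at h2
      rw [this]; simp [Nat.choose_eq_zero_of_lt]
    · have hs : NC 1 (r+1) = powersetCard (r+1) (range 1) := by
        ext S; rw [mem_NC, mem_powersetCard]
        refine ⟨fun h => h.1, fun h => ⟨h, fun i hi hi' => ?_⟩⟩
        have := h.1 hi'; simp at this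
      rw [hs, card_powersetCard, card_range]
      rcases r with _ | r
      · simp
      · rw [Nat.choose_eq_zero_of_lt (by omega), Nat.choose_eq_zero_of_lt (by omega)]
    · rw [NC_rec, ih _ (by omega), ih _ (by omega)]
      by_cases h : r ≤ m + 1
      · rw [show m + 1 + 1 + 1 - (r + 1) = (m + 1 - r) + 1 by omega, Nat.choose_succ_succ',
          show m + 1 + 1 - (r + 1) = m + 1 - r by omega, add_comm]
      · rw [Nat.choose_eq_zero_of_lt (by omega), Nat.choose_eq_zero_of_lt (by omega), Nat.choose_eq_zero_of_lt (by omega)]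

lemma stable_exists {n k x y : ℕ} (hk : 2 ≤ k) (hn : 2 * k + 1 ≤ n) (hx : 1 ≤ x) (hxy : x + 1 < y) (hy : y ≤ n)
    (hna : ¬ (x = 1 ∧ y = n)) :
    ∃ R ⊆ Icc 1 n, #R = k ∧ x ∈ R ∧ y ∈ R ∧ ¬ IsUnstable n R := by
  obtain ⟨p, hp⟩ : ∃ p, p = (y - x) / 2 := ⟨_, rfl⟩
  obtain ⟨q, hq⟩ : ∃ q, q = (n - (y - x)) / 2 := ⟨_, rfl⟩
  let f : ℕ → ℕ := fun t => if t < p then x + 2 * t else if y + 2 * (t - p) ≤ n then y + 2 * (t - p) else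
    y + 2 * (t - p) - n
  have hinj : Set.InjOn f (range (p + q) : Set ℕ) := by
    intro s hs t ht h
    simp only [coe_range, Set.mem_Iio] at hs ht
    simp only [f] at h
    split_ifs at h <;> omega
  have hcard : #((range (p+q)).image f) = p + q := by
    rw [card_image_of_injOn hinj, card_range]
  have hx0 : x ∈ (range (p+q)).image f := by
    refine mem_image.2 ⟨0, by simp; omega, ?_⟩
    simp only [f]; split_ifs <;> omega
  have hy0 : y ∈ (range (p+q)).image f := by
    refine mem_image.2 ⟨p, by simp; omega, ?_⟩
    simp only [f]; split_ifs <;> omega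
  obtain ⟨R, h1, h2, h3⟩ := exists_subsuperset_card_eq (s := {x, y}) (t := (range (p+q)).image f) (n := k)
    (by intro z hz; simp only [mem_insert, mem_singleton] at hz; rcases hz with rfl | rfl <;> assumption)
    (by have := card_le_two (a := x) (b := y); omega) (by omega)
  refine ⟨R, ?_, h3, h1 (by simp), h1 (by simp), ?_⟩
  · intro z hz
    obtain ⟨t, ht, rfl⟩ := mem_image.1 (h2 hz)
    simp only [mem_range] at ht
    simp only [f, mem_Icc]; split_ifs <;> omega
  · rintro (⟨i, hi, hi'⟩ | ⟨hi, hi'⟩)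
    · obtain ⟨t, ht, e⟩ := mem_image.1 (h2 hi)
      obtain ⟨s, hs, e'⟩ := mem_image.1 (h2 hi')
      simp only [mem_range] at ht hs
      simp only [f] at e e'
      split_ifs at e e' <;> omega
    · obtain ⟨t, ht, e⟩ := mem_image.1 (h2 hi)
      obtain ⟨s, hs, e'⟩ := mem_image.1 (h2 hi')
      simp only [mem_range] at ht hs
      simp only [f] at e e'
      split_ifs at e e' <;> omega

lemma star_bound {n c x : ℕ} {F} (hn : 2 * (c + 1) ≤ n) (hF : Unif (Icc 1 n) (c+1) F) (hu : ∀ S ∈ F, IsUnstable n S)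
    (hx : ∀ S ∈ F, x ∈ S) (hxV : x ∈ Icc 1 n) (hn3 : 3 ≤ n) : #F + (n - (c + 2)).choose c ≤ (n - 1).choose c := by
  have hcl : #(link x F) = #F := by
    have := card_link_del x F
    have h0 : del x F = ∅ := by
      ext S; simp only [mem_del, notMem_empty, iff_false]; rintro ⟨h, h'⟩; exact h' (hx S h)
    rw [h0] at this; simpa using this
  simp only [mem_Icc] at hxV
  let f : ℕ → ℕ := fun e => if x + 2 + e ≤ n then x + 2 + e else x + 2 + e - n
  have finj : ∀ s < n, ∀ t < n, f s = f t → s = t := by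
    intro s hs t ht h
    simp only [f] at h
    split_ifs at h <;> omega
  have hr : ∀ S ∈ NC (n-3) c, ∀ s ∈ S, s < n - 3 := fun S hS s hs => by
    simpa using (mem_NC.1 hS).1.1 hs
  have hinj : Set.InjOn (fun S => S.image f) (NC (n-3) c : Set (Finset ℕ)) := by
    have : ∀ S ∈ NC (n-3) c, ∀ T ∈ NC (n-3) c, S.image f = T.image f → S ⊆ T := by
      intro S hS T hT h s hs
      have : f s ∈ T.image f := h ▸ mem_image_of_mem f hs
      obtain ⟨t, ht, e⟩ := mem_image.1 this
      have h1 := hr S hS s hs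
      have h2 := hr T hT t ht
      rwa [← finj t (by omega) s (by omega) e]
    intro S hS T hT h
    exact Subset.antisymm (this S hS T hT h) (this T hT S hS h.symm)
  have hd : Disjoint (link x F) ((NC (n-3) c).image (fun S => S.image f)) := by
    rw [disjoint_left]
    intro T hT hT'
    obtain ⟨S, hS, rfl⟩ := mem_image.1 hT'
    rw [mem_link] at hT
    have h1 := hr S hS
    have h2 := (mem_NC.1 hS).2
    rcases hu _ hT.2 with ⟨i, hi, hi'⟩ | ⟨hi, hi'⟩
    · simp only [mem_insert, mem_image] at hi hi'
      rcases hi with hi | ⟨s, hs, e⟩ <;> rcases hi' with hi' | ⟨t, ht, e'⟩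
      · omega
      · have := h1 t ht
        simp only [f] at e'; split_ifs at e' <;> omega
      · have := h1 s hs
        simp only [f] at e; split_ifs at e <;> omega
      · have := h1 t ht
        have := h1 s hs
        have : t = s + 1 := by
          simp only [f] at e e'; split_ifs at e e' <;> omega
        exact h2 s hs (this ▸ ht)
    · simp only [mem_insert, mem_image] at hi hi'
      rcases hi with hi | ⟨s, hs, e⟩ <;> rcases hi' with hi' | ⟨t, ht, e'⟩
      · omega
      · have := h1 t ht
        simp only [f] at e'; split_ifs at e' <;> omega
      · have := h1 s hs
        simp only [f] at e; split_ifs at e <;> omega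
      · have := h1 t ht
        have := h1 s hs
        have : t = s + 1 := by
          simp only [f] at e e'; split_ifs at e e' <;> omega
        exact h2 s hs (this ▸ ht)
  have hs : link x F ∪ ((NC (n-3) c).image (fun S => S.image f)) ⊆ ((Icc 1 n).erase x).powersetCard c := by
    apply union_subset hF.link.sub
    intro T hT'
    obtain ⟨S, hS, rfl⟩ := mem_image.1 hT'
    have h1 := hr S hS
    rw [mem_powersetCard]
    constructor
    · intro z hz
      obtain ⟨s, hs, rfl⟩ := mem_image.1 hz
      have := h1 s hs
      simp only [mem_erase, mem_Icc, f]
      split_ifs <;> omega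
    · rw [card_image_of_injOn, (mem_NC.1 hS).1.2]
      intro s hs t ht e
      have h3 := h1 s hs
      have h4 := h1 t ht
      exact finj s (by omega) t (by omega) e
  have := card_le_card hs
  rw [card_union_of_disjoint hd, card_image_of_injOn hinj, hcl, card_NC, card_powersetCard, card_erase_of_mem (by simpa using hxV),
    Nat.card_Icc, show n - 3 + 1 - c = n - (c + 2) by omega] at this
  simpa using this

lemma star_attain {n c : ℕ} (hn : 2 * (c + 1) ≤ n) (hn3 : 3 ≤ n) : ∃ F, Unif (Icc 1 n) (c+1) F ∧ (∀ S ∈ F, IsUnstable n S) ∧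
    (∀ S ∈ F, 1 ∈ S) ∧ (n - 1).choose c ≤ #F + (n - (c + 2)).choose c := by
  classical
  let P := {S ∈ (Icc 1 n).powersetCard (c+1) | 1 ∈ S}
  refine ⟨{S ∈ P | IsUnstable n S}, ?_, ?_, ?_, ?_⟩
  · intro S hS
    simp only [P, mem_filter, mem_powersetCard] at hS
    exact hS.1.1
  · intro S hS; exact (mem_filter.1 hS).2
  · intro S hS; exact (mem_filter.1 (mem_filter.1 hS).1).2
  · have h1 : #P = (n-1).choose c := by
      have e : P = (((Icc 1 n).erase 1).powersetCard c).image (fun S => insert 1 S) := by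
        ext S
        simp only [P, mem_filter, mem_powersetCard, mem_image]
        constructor
        · rintro ⟨⟨a, b⟩, d⟩
          exact ⟨S.erase 1, ⟨erase_subset_erase _ a, by rw [card_erase_of_mem d]; omega⟩, insert_erase d⟩
        · rintro ⟨T, ⟨a, b⟩, rfl⟩
          have h1 : 1 ∉ T := fun h => by simpa using a h
          refine ⟨⟨insert_subset (by simp; omega) (a.trans (erase_subset _ _)), ?_⟩, mem_insert_self _ _⟩
          rw [card_insert_of_notMem h1, b]
      rw [e, card_image_of_injOn, card_powersetCard, card_erase_of_mem (by simp; omega), Nat.card_Icc]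
      · simp
      · intro S hS T hT h
        simp only [mem_coe, mem_powersetCard] at hS hT
        have h1 : 1 ∉ T := fun h => by simpa using hT.1 h
        have h2 : 1 ∉ S := fun h => by simpa using hS.1 h
        simp only at h
        rw [← erase_insert h2, h, erase_insert h1]
    rw [← h1, ← card_filter_add_card_filter_not (s := P) (IsUnstable n)]
    apply Nat.add_le_add_left
    rw [show n - (c + 2) = n - 3 + 1 - c by omega, ← card_NC]
    have prop : ∀ S ∈ {S ∈ P | ¬ IsUnstable n S}, 1 ∈ S ∧ #S = c + 1 ∧ (∀ i ∈ S, i + 1 ∉ S) ∧ (∀ s ∈ S.erase 1, 3 ≤ s ∧ s < n) := by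
      intro S hS
      simp only [P, mem_filter, mem_powersetCard, IsUnstable, not_or, not_exists, not_and] at hS
      refine ⟨hS.1.2, hS.1.1.2, hS.2.1, ?_⟩
      intro s hs
      rw [mem_erase] at hs
      have h1 := hS.1.1.1 hs.2
      have h2 : s ≠ 2 := by rintro rfl; exact hS.2.1 1 hS.1.2 hs.2
      have h3 : s ≠ n := by rintro rfl; exact hS.2.2 hs.2 hS.1.2
      simp at h1; omega
    apply card_le_card_of_injOn (fun S => (S.erase 1).image (fun s => s - 3))
    · intro S hS
      obtain ⟨p1, p2, p3, p4⟩ := prop S hS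
      simp only [mem_coe, mem_NC]
      refine ⟨⟨?_, ?_⟩, ?_⟩
      · intro z hz
        obtain ⟨s, hs, rfl⟩ := mem_image.1 hz
        have := p4 s hs
        simp; omega
      · rw [card_image_of_injOn, card_erase_of_mem p1, p2]; rfl
        intro s hs t ht h
        have := p4 s hs
        have := p4 t ht
        simp only at h
        omega
      · intro i hi hi'
        obtain ⟨s, hs, e⟩ := mem_image.1 hi
        obtain ⟨t, ht, e'⟩ := mem_image.1 hi'
        have := p4 s hs
        have := p4 t ht
        have : t = s + 1 := by omega
        exact p3 s (mem_of_mem_erase hs) (this ▸ mem_of_mem_erase ht)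
    · have : ∀ S ∈ {S ∈ P | ¬ IsUnstable n S}, ∀ T ∈ {S ∈ P | ¬ IsUnstable n S}, 
          (S.erase 1).image (fun s => s - 3) = (T.erase 1).image (fun s => s - 3) → S ⊆ T := by
        intro S hS T hT h s hs
        by_cases h1 : s = 1
        · rw [h1]; exact (prop T hT).1
        have hs' : s ∈ S.erase 1 := mem_erase.2 ⟨h1, hs⟩
        have : s - 3 ∈ (T.erase 1).image (fun s => s - 3) := h ▸ mem_image_of_mem _ hs'
        obtain ⟨t, ht, e⟩ := mem_image.1 this
        have := (prop S hS).2.2.2 s hs'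
        have := (prop T hT).2.2.2 t ht
        have : s = t := by omega
        exact this ▸ mem_of_mem_erase ht
      intro S hS T hT h
      exact Subset.antisymm (this S hS T hT h) (this T hT S hS h.symm)

def adj (n x y : ℕ) : Prop := y = x + 1 ∨ x = y + 1 ∨ (x = 1 ∧ y = n) ∨ (x = n ∧ y = 1)

lemma two_cover {n c x y : ℕ} {F} (hn : 2 * c + 5 ≤ n) (hF : Unif (Icc 1 n) (c+2) F) (hu : ∀ S ∈ F, IsUnstable n S)
    (hc : Cross F F) (nt : ∀ x, ∃ S ∈ F, x ∉ S) (hcov : ∀ S ∈ F, x ∈ S ∨ y ∈ S)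
    (hx : x ∈ Icc 1 n) (hy : y ∈ Icc 1 n) (hxy : x ≠ y) (hna : ¬ adj n x y) :
    #F + (n - (c + 3)).choose (c + 1) ≤ (n - 1).choose (c + 1) := by
  have hR : ∃ R ⊆ Icc 1 n, #R = c + 2 ∧ x ∈ R ∧ y ∈ R ∧ ¬ IsUnstable n R := by
    unfold adj at hna
    simp only [mem_Icc] at hx hy
    rcases Nat.lt_or_gt_of_ne hxy with h | h
    · exact stable_exists (by omega) (by omega) hx.1 (by omega) hy.2 (by omega)
    · obtain ⟨R, a, b, d, e, f⟩ := stable_exists (n := n) (k := c + 2) (x := y) (y := x) (by omega) (by omega) hy.1 (by omega) hx.2 (by omega)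
      exact ⟨R, a, b, e, d, f⟩
  obtain ⟨R, hR1, hR2, hxR, hyR, hRs⟩ := hR
  have hW := card_W hx hy hxy
  rw [Nat.card_Icc, Nat.add_sub_cancel] at hW
  obtain ⟨S1, hS1, hS1y⟩ := nt y
  obtain ⟨S2, hS2, hS2x⟩ := nt x
  have hS1x := (hcov S1 hS1).resolve_right hS1y
  have hS2y := (hcov S2 hS2).resolve_left hS2x
  have hAB := cross_weak (V := ((Icc 1 n).erase y).erase x) hF.A hF.B (cross_AB hc (x := x) (y := y)) ⟨S1.erase x, by
    rw [mem_link, mem_del, insert_erase hS1x]; exact ⟨notMem_erase _ _, hS1, hS1y⟩⟩ ⟨S2.erase y, by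
    rw [mem_link, mem_del, insert_erase hS2y]; exact ⟨notMem_erase _ _, hS2, hS2x⟩⟩ (by omega)
  have hL : #(link x (link y F)) + 1 ≤ (n - 2).choose c := by
    have hRR : (R.erase y).erase x ∉ link x (link y F) := by
      simp only [mem_link]
      rw [insert_erase (mem_erase.2 ⟨hxy, hxR⟩), insert_erase hyR]
      exact fun h => hRs (hu _ h.2.2)
    rw [← card_insert_of_notMem hRR, ← hW]
    apply card_all
    intro S hS
    rw [mem_insert] at hS
    rcases hS with rfl | hS
    · refine ⟨erase_subset_erase _ (erase_subset_erase _ hR1), ?_⟩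
      rw [card_W hxR hyR hxy]; omega
    · exact (hF.link.link) S hS
  have hsp := split4 hxy F
  rw [del_del_empty hcov, card_empty] at hsp
  have hpas := pascal (n := n) (c := c) (by omega)
  rw [hW, show n - 2 - (c + 1) = n - (c + 3) by omega] at hAB
  omega

theorem upper {n c : ℕ} {F} (hn : 2 * c + 5 ≤ n) (hF : Unif (Icc 1 n) (c+2) F) (hu : ∀ S ∈ F, IsUnstable n S)
    (hc : Cross F F) : #F + (n - (c + 3)).choose (c + 1) ≤ (n - 1).choose (c + 1) := by
  by_cases h1 : ∃ x, ∀ S ∈ F, x ∈ S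
  · obtain ⟨x, hx⟩ := h1
    rcases F.eq_empty_or_nonempty with rfl | ⟨S, hS⟩
    · rw [card_empty, zero_add]; exact Nat.choose_le_choose _ (by omega)
    · exact star_bound (by omega) hF hu hx ((hF S hS).1 (hx S hS)) (by omega)
  push Not at h1
  by_cases h3 : ∀ x y, ∃ S ∈ F, x ∉ S ∧ y ∉ S
  · rcases Nat.eq_zero_or_pos c with rfl | hc1
    · exfalso
      obtain ⟨S, hS, -⟩ := h1 0
      obtain ⟨p, q, hpq, rfl⟩ := card_eq_two.1 (hF S hS).2
      obtain ⟨T, hT, hp, hq⟩ := h3 p q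
      obtain ⟨x, hx, hx'⟩ := hc _ hS _ hT
      simp only [mem_insert, mem_singleton] at hx
      rcases hx with rfl | rfl <;> contradiction
    · have := hm3 (V := Icc 1 n) hc1 (by simpa using hn) _ F rfl hF hc h3
      simpa using this
  push Not at h3
  obtain ⟨x, y, hcov⟩ := h3
  have hcov : ∀ S ∈ F, x ∈ S ∨ y ∈ S := fun S hS => by have := hcov S hS; tauto
  obtain ⟨S1, hS1, hS1y⟩ := h1 y
  obtain ⟨S2, hS2, hS2x⟩ := h1 x
  have hS1x := (hcov S1 hS1).resolve_right hS1y
  have hS2y := (hcov S2 hS2).resolve_left hS2x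
  have hx := (hF S1 hS1).1 hS1x
  have hy := (hF S2 hS2).1 hS2y
  have hxy : x ≠ y := by rintro rfl; exact hS2x hS2y
  by_cases hna : adj n x y
  swap
  · exact two_cover hn hF hu hc h1 hcov hx hy hxy hna
  have mA : ∀ S ∈ F, x ∈ S → y ∉ S → S.erase x ∈ link x (del y F) := by
    intro S hS h1 h2
    rw [mem_link, mem_del, insert_erase h1]
    exact ⟨notMem_erase _ _, hS, h2⟩
  have mB : ∀ S ∈ F, y ∈ S → x ∉ S → S.erase y ∈ link y (del x F) := by
    intro S hS h1 h2
    rw [mem_link, mem_del, insert_erase h1]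
    exact ⟨notMem_erase _ _, hS, h2⟩
  have m1 := mA S1 hS1 hS1x hS1y
  have m2 := mB S2 hS2 hS2y hS2x
  have hW := card_W hx hy hxy
  rw [Nat.card_Icc, Nat.add_sub_cancel] at hW
  have uA : Unif (((Icc 1 n).erase y).erase x) (c+1) (link x (del y F)) := hF.A
  have uB : Unif (((Icc 1 n).erase y).erase x) (c+1) (link y (del x F)) := hF.B
  have covA : ∀ z, (∀ S ∈ link x (del y F), z ∈ S) → ¬ adj n y z →
      #F + (n - (c + 3)).choose (c + 1) ≤ (n - 1).choose (c + 1) := by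
    intro z hz hna
    have hzV := (uA _ m1).1 (hz _ m1)
    simp only [mem_erase] at hzV
    refine two_cover hn hF hu hc h1 (x := y) (y := z) (fun S hS => ?_) hy hzV.2.2 (Ne.symm hzV.2.1) hna
    by_cases hyS : y ∈ S
    · exact Or.inl hyS
    · exact Or.inr (mem_of_mem_erase (hz _ (mA S hS ((hcov S hS).resolve_right hyS) hyS)))
  have covB : ∀ z, (∀ S ∈ link y (del x F), z ∈ S) → ¬ adj n x z →
      #F + (n - (c + 3)).choose (c + 1) ≤ (n - 1).choose (c + 1) := by
    intro z hz hna
    have hzV := (uB _ m2).1 (hz _ m2)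
    simp only [mem_erase] at hzV
    refine two_cover hn hF hu hc h1 (x := x) (y := z) (fun S hS => ?_) hx hzV.2.2 (Ne.symm hzV.1) hna
    by_cases hxS : x ∈ S
    · exact Or.inl hxS
    · exact Or.inr (mem_of_mem_erase (hz _ (mB S hS ((hcov S hS).resolve_left hxS) hxS)))
  have common : ∀ z ∈ ((Icc 1 n).erase y).erase x, (∀ S ∈ link x (del y F), z ∈ S) → (∀ S ∈ link y (del x F), z ∈ S) →
      #F + (n - (c + 3)).choose (c + 1) ≤ (n - 1).choose (c + 1) := by
    intro z hz hzA hzB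
    by_cases h1 : adj n y z
    · refine covB z hzB ?_
      unfold adj at *
      simp only [mem_erase, mem_Icc] at *
      omega
    · exact covA z hzA h1
  rcases Nat.eq_zero_or_pos c with rfl | hc1
  · obtain ⟨z, hz⟩ := card_eq_one.1 (uA _ m1).2
    have cr := cross_AB hc (x := x) (y := y)
    have hB : ∀ S ∈ link y (del x F), S = {z} := by
      intro S hS
      obtain ⟨w, hw, hw'⟩ := cr _ m1 _ hS
      obtain ⟨v, rfl⟩ := card_eq_one.1 (uB _ hS).2
      rw [hz] at hw; simp at hw hw'; rw [← hw, hw']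
    refine common z ((uA _ m1).1 (by rw [hz]; simp)) ?_ ?_
    · intro S hS
      obtain ⟨w, hw, hw'⟩ := cr _ hS _ m2
      rw [hB _ m2] at hw'; simp at hw'; rwa [← hw']
    · intro S hS; rw [hB S hS]; simp
  have pick : ∀ S, S ⊆ ((Icc 1 n).erase y).erase x → #S = c + 1 → (∃ z ∈ S, ¬ adj n y z) ∧ (∃ z ∈ S, ¬ adj n x z) := by
    intro S hS hcS
    obtain ⟨p, q, hp, hq, hpq⟩ := one_lt_card_iff.1 (show 1 < #S by omega)
    have hp' := hS hp
    have hq' := hS hq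
    simp only [mem_erase, mem_Icc] at hp' hq' hx hy
    constructor
    · by_cases h : adj n y p
      · refine ⟨q, hq, ?_⟩
        unfold adj at *; omega
      · exact ⟨p, hp, h⟩
    · by_cases h : adj n x p
      · refine ⟨q, hq, ?_⟩
        unfold adj at *; omega
      · exact ⟨p, hp, h⟩
  rcases cross_eq uA uB (cross_AB hc) ⟨_, m1⟩ ⟨_, m2⟩ (by omega) (by omega) with h | h | h | ⟨h2, z, hz, hzA, hzB, cA, cB⟩
  · have hL := card_all (hF.link (m := y)).link (W := ((Icc 1 n).erase y).erase x)
    have hsp := split4 hxy F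
    rw [del_del_empty hcov, card_empty] at hsp
    have hpas := pascal (n := n) (c := c) (by omega)
    rw [hW] at h hL
    rw [show n - 2 - (c + 1) = n - (c + 3) by omega] at h
    omega
  · obtain ⟨z, hz, hz'⟩ := (pick _ (uA _ m1).1 (uA _ m1).2).1
    refine covA z (fun S hS => ?_) hz'
    rwa [card_le_one.1 h.le _ hS _ m1]
  · obtain ⟨z, hz, hz'⟩ := (pick _ (uB _ m2).1 (uB _ m2).2).2
    refine covB z (fun S hS => ?_) hz'
    rwa [card_le_one.1 h.le _ hS _ m2]
  · exact common z hz hzA hzB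

theorem upper_base {k : ℕ} {F} (hk : 2 ≤ k) (hF : Unif (Icc 1 (2 * k)) k F) (hu : ∀ S ∈ F, IsUnstable (2 * k) S)
    (hc : Cross F F) : 2 * #F + 2 ≤ (2 * k).choose k := by
  let O := (range k).image (fun t => 2 * t + 1)
  let E := (range k).image (fun t => 2 * t + 2)
  have cO : #O = k := by
    rw [card_image_of_injective _ (fun a b h => by simp at h; exact h), card_range]
  have cE : #E = k := by
    rw [card_image_of_injective _ (fun a b h => by simp at h; exact h), card_range]
  have hO : O ∉ F := by
    intro h
    rcases hu O h with ⟨i, hi, hi'⟩ | ⟨hi, hi'⟩ <;> simp [O] at hi hi' <;> grind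
  have hE : E ∉ F := by
    intro h
    rcases hu E h with ⟨i, hi, hi'⟩ | ⟨hi, hi'⟩ <;> simp [E] at hi hi' <;> grind
  have meet : ∀ S ∈ F, ∃ x, x ∈ O ∧ x ∈ S := by
    intro S hS
    by_contra! h
    apply hE
    have : S ⊆ E := by
      intro x hx
      have h1 := (hF S hS).1 hx
      have h2 : x ∉ O := fun h' => h x h' hx
      simp only [mem_Icc] at h1
      rcases Nat.even_or_odd' x with ⟨t, ht | ht⟩
      · exact mem_image.2 ⟨t - 1, by simp; omega, by omega⟩
      · exact absurd (mem_image.2 ⟨t, by simp; omega, by omega⟩) h2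
    rw [← eq_of_subset_of_card_le this (by rw [cE, (hF S hS).2])]
    exact hS
  have uF : Unif (Icc 1 (2 * k)) k (insert O F) := by
    intro S hS
    rw [mem_insert] at hS
    rcases hS with rfl | hS
    · refine ⟨?_, cO⟩
      intro x hx
      obtain ⟨t, ht, rfl⟩ := mem_image.1 hx
      simp at *; omega
    · exact hF S hS
  have cF : Cross (insert O F) (insert O F) := by
    intro S hS T hT
    rw [mem_insert] at hS hT
    rcases hS with rfl | hS <;> rcases hT with rfl | hT
    · obtain ⟨x, hx⟩ : O.Nonempty := card_pos.1 (by omega)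
      exact ⟨x, hx, hx⟩
    · exact meet T hT
    · obtain ⟨x, hx, hy⟩ := meet S hS
      exact ⟨x, hy, hx⟩
    · exact hc S hS T hT
  have := cross_base uF uF cF (by simp)
  rw [card_insert_of_notMem hO] at this
  omega

end HM

/-- For `k ≥ 2` and `n ≥ 2k`, the independence number of `U(n,k)` (the largest size of
a family of pairwise intersecting unstable `k`-subsets of `[n]`) equals
`C(n-1,k-1) − C(n-k-1,k-1)`. -/
theorem stmt9 (n k : ℕ) (hk : 2 ≤ k) (hn : 2 * k ≤ n) :
    (∀ F : Finset (Finset ℕ),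
      (∀ A ∈ F, A ⊆ Finset.Icc 1 n ∧ A.card = k ∧ IsUnstable n A) →
      (∀ A ∈ F, ∀ B ∈ F, A ≠ B → ¬ Disjoint A B) →
      F.card ≤ Nat.choose (n - 1) (k - 1) - Nat.choose (n - k - 1) (k - 1)) ∧
    (∃ F : Finset (Finset ℕ),
      (∀ A ∈ F, A ⊆ Finset.Icc 1 n ∧ A.card = k ∧ IsUnstable n A) ∧
      (∀ A ∈ F, ∀ B ∈ F, A ≠ B → ¬ Disjoint A B) ∧
      F.card = Nat.choose (n - 1) (k - 1) - Nat.choose (n - k - 1) (k - 1)) := by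
  obtain ⟨c, rfl⟩ : ∃ c, k = c + 2 := ⟨k - 2, by omega⟩
  have up : ∀ F : Finset (Finset ℕ),
      (∀ A ∈ F, A ⊆ Finset.Icc 1 n ∧ A.card = c + 2 ∧ IsUnstable n A) →
      (∀ A ∈ F, ∀ B ∈ F, A ≠ B → ¬ Disjoint A B) →
      F.card ≤ Nat.choose (n - 1) (c + 2 - 1) - Nat.choose (n - (c + 2) - 1) (c + 2 - 1) := by
    intro F hF hd
    have uF : HM.Unif (Finset.Icc 1 n) (c+2) F := fun S hS => ⟨(hF S hS).1, (hF S hS).2.1⟩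
    have hu : ∀ S ∈ F, IsUnstable n S := fun S hS => (hF S hS).2.2
    have hc : HM.Cross F F := by
      intro S hS T hT
      by_cases h : S = T
      · subst h
        obtain ⟨x, hx⟩ : S.Nonempty := Finset.card_pos.1 (by rw [(hF S hS).2.1]; omega)
        exact ⟨x, hx, hx⟩
      · exact Finset.not_disjoint_iff.1 (hd S hS T hT h)
    rw [show n - (c + 2) - 1 = n - (c + 3) by omega, show c + 2 - 1 = c + 1 by omega]
    rcases Nat.eq_or_lt_of_le hn with rfl | hlt
    · have := HM.upper_base hk uF hu hc
      have e : (2 * (c+2)).choose (c+2) = (2 * c + 3).choose (c + 1) + (2 * c + 3).choose (c + 2) := by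
        rw [show 2 * (c+2) = 2 * c + 3 + 1 by ring, Nat.choose_succ_succ']
      have e2 : (2 * c + 3).choose (c + 2) = (2 * c + 3).choose (c + 1) := 
        Nat.choose_symm_of_eq_add (by omega)
      rw [show 2 * (c + 2) - (c + 3) = c + 1 by omega, Nat.choose_self, show 2 * (c + 2) - 1 = 2 * c + 3 by omega]
      omega
    · have := HM.upper (by omega) uF hu hc
      omega
  refine ⟨up, ?_⟩
  obtain ⟨F, h1, h2, h3, h4⟩ := HM.star_attain (n := n) (c := c + 1) (by omega) (by omega)
  have a1 : ∀ A ∈ F, A ⊆ Finset.Icc 1 n ∧ A.card = c + 2 ∧ IsUnstable n A := 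
    fun A hA => ⟨(h1 A hA).1, (h1 A hA).2, h2 A hA⟩
  have a2 : ∀ A ∈ F, ∀ B ∈ F, A ≠ B → ¬ Disjoint A B := 
    fun A hA B hB _ => Finset.not_disjoint_iff.2 ⟨1, h3 A hA, h3 B hB⟩
  refine ⟨F, a1, a2, le_antisymm (up F a1 a2) ?_⟩
  rw [show n - (c + 2) - 1 = n - (c + 1 + 2) by omega, show c + 2 - 1 = c + 1 by omega]
  omega
end

section
/- For integers d ≥ 2, n, k with n ≥ 2k, set t = ⌊n/(2k+d-2)⌋ and m = d·t − 1, and let J_1, ..., J_t be pairwise disjoint intervals of [n] of 2k+d-2 consecutive elements each, with S_i the family of stable k-subsets of J_i (with respect to the cyclic order of J_i). Then for any coloring c of the stable k-subsets of [n] with m colors, there exist two disjoint sets A, B in S_1 ∪ ... ∪ S_t with c(A) = c(B). -/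
/-- `A` is a stable `k`-subset of the interval `J = {a, ..., b}` with respect to the
natural cyclic order of `J` (where `b` precedes `a`): `A ⊆ J`, `|A| = k`, no two
consecutive elements, and not both endpoints `a` and `b`. -/
def IsStableInInterval (a b k : ℕ) (A : Finset ℕ) : Prop :=
  A ⊆ Finset.Icc a b ∧ A.card = k ∧
    (∀ x, ¬(x ∈ A ∧ x + 1 ∈ A)) ∧ ¬(b ∈ A ∧ a ∈ A)


namespace SchrijverAux

/-- Sign of an encoded label (parity bit). -/
def sg (x : ℕ) : Bool := decide (x % 2 = 1)

/-- Indicator that the signs alternate along the list, starting from `b`. -/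
def alt : Bool → List ℕ → ZMod 2
  | _, [] => 1
  | b, x :: l => if sg x = b then alt (!b) l else 0

/-- Indicator for multisets. -/
noncomputable def altM (b : Bool) (M : Multiset ℕ) : ZMod 2 := alt b (M.sort (· ≤ ·))

theorem z2 (x : ZMod 2) : x + x = 0 := by revert x; decide

theorem alt_sum (l : List ℕ) (hl : l.Pairwise (· ≤ ·)) (hne : l ≠ []) (b : Bool) :
    (l.map (fun x => alt b (l.erase x))).sum = alt b l + alt (!b) l := by
  induction l generalizing b with
  | nil => exact absurd rfl hne
  | cons x l ih =>
    rw [List.pairwise_cons] at hl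
    have key : ∀ y ∈ l, (x :: l).erase y = x :: l.erase y := by
      intro y hy
      by_cases hxy : x = y
      · subst hxy
        cases l with
        | nil => simp at hy
        | cons z l =>
          have h1 := hl.1 z (by simp)
          have h2 : z ≤ x := by
            rcases List.mem_cons.1 hy with h | h
            · exact h.ge
            · exact (List.pairwise_cons.1 hl.2).1 x h
          have : z = x := le_antisymm h2 h1
          subst this
          simp
      · rw [List.erase_cons_tail]
        simpa using hxy
    have e1 : ((x :: l).map (fun y => alt b ((x :: l).erase y))).sum
        = alt b l + (l.map (fun y => alt b (x :: l.erase y))).sum := by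
      rw [List.map_cons, List.sum_cons, List.erase_cons_head]
      congr 2
      apply List.map_congr_left
      intro y hy
      rw [key y hy]
    rw [e1]
    by_cases hl0 : l = []
    · subst hl0
      simp only [List.map_nil, List.sum_nil, alt]
      cases b <;> cases sg x <;> simp
    · have hi := ih hl.2 hl0
      by_cases hs : sg x = b
      · have hs' : sg x ≠ !b := by rw [hs]; cases b <;> simp
        simp only [alt, if_pos hs, if_neg hs']
        rw [hi (!b), Bool.not_not, add_comm (alt (!b) l), ← add_assoc, z2]
        simp
      · have hs' : sg x = !b := by
          revert hs; cases b <;> cases sg x <;> simp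
        simp only [alt, if_pos hs', if_neg hs]
        simp

theorem altM_sum (M : Multiset ℕ) (hM : M ≠ 0) (b : Bool) :
    (M.map (fun x => altM b (M.erase x))).sum = altM b M + altM (!b) M := by
  have h := alt_sum (M.sort (· ≤ ·)) (Multiset.pairwise_sort _ _) (by
    intro h
    apply hM
    rw [← Multiset.sort_eq M (· ≤ ·), h]; rfl) b
  unfold altM
  rw [← h, ← Multiset.sum_coe, ← Multiset.map_coe, Multiset.sort_eq]
  congr 1
  apply Multiset.map_congr rfl
  intro x hx
  congr 1
  apply List.Perm.eq_of_pairwise (le := (· ≤ ·))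
  · intro a b _ _ h1 h2; exact le_antisymm h1 h2
  · exact Multiset.pairwise_sort _ _
  · exact (Multiset.pairwise_sort M (· ≤ ·)).sublist (List.erase_sublist)
  · rw [← Multiset.coe_eq_coe, Multiset.sort_eq, ← Multiset.coe_erase, Multiset.sort_eq]

/-- Flip the sign of an encoded label. -/
def fl (x : ℕ) : ℕ := if x % 2 = 1 then x - 1 else x + 1

theorem sg_fl (x : ℕ) : sg (fl x) = !sg x := by
  unfold sg fl
  split_ifs with h
  · have : (x - 1) % 2 ≠ 1 := by omega
    simp [h, this]
  · have : (x + 1) % 2 = 1 := by omega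
    simp [h, this]

theorem alt_fl (l : List ℕ) (b : Bool) : alt b (l.map fl) = alt (!b) l := by
  induction l generalizing b with
  | nil => rfl
  | cons x l ih =>
    simp only [List.map_cons, alt, sg_fl, ih]
    cases b <;> cases sg x <;> simp

theorem altM_fl (M : Multiset ℕ) (hM : ∀ x ∈ M, ∀ y ∈ M, x / 2 = y / 2 → x = y) (b : Bool) :
    altM b (M.map fl) = altM (!b) M := by
  unfold altM
  rw [← alt_fl]
  congr 1
  apply List.Perm.eq_of_pairwise (le := (· ≤ ·))
  · intro a b _ _ h1 h2; exact le_antisymm h1 h2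
  · exact Multiset.pairwise_sort _ _
  · rw [List.pairwise_map]
    refine List.Pairwise.imp_of_mem ?_ (Multiset.pairwise_sort M (· ≤ ·))
    intro x y hx hy hxy
    have := hM x (by simpa using hx) y (by simpa using hy)
    unfold fl
    split_ifs <;> omega
  · rw [← Multiset.coe_eq_coe, Multiset.sort_eq, ← Multiset.map_coe, Multiset.sort_eq]

theorem alt_strict (l : List ℕ) (hl : l.Pairwise (· ≤ ·))
    (hc : ∀ x ∈ l, ∀ y ∈ l, x / 2 = y / 2 → x = y) (b : Bool) (m lo : ℕ)
    (hlo : ∀ x ∈ l, lo ≤ x / 2) (hm : ∀ x ∈ l, x / 2 < m) (h : alt b l ≠ 0) :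
    l = [] ∨ l.length + lo ≤ m := by
  induction l generalizing b lo with
  | nil => left; rfl
  | cons x l ih =>
    right
    rw [List.pairwise_cons] at hl
    simp only [alt] at h
    split_ifs at h with hs
    · have hx := hm x (by simp)
      have hx2 := hlo x (by simp)
      cases l with
      | nil => simp; omega
      | cons z l =>
        have h3 : sg z = !b := by
          by_contra h4
          simp [alt, h4] at h
        have hzx : z / 2 ≠ x / 2 := by
          intro h5
          have := hc z (by simp) x (by simp) h5
          rw [this, hs] at h3
          cases b <;> simp at h3
        have := ih hl.2 (fun x hx y hy => hc x (by simp [hx]) y (by simp [hy])) (!b) (lo + 1) (by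
          intro y hy
          have h6 := hl.1 z (by simp)
          have h7 : z ≤ y := by
            rcases List.mem_cons.1 hy with h | h
            · exact h.ge
            · exact (List.pairwise_cons.1 hl.2).1 y h
          omega) (fun y hy => hm y (by simp [hy])) h
        simp at this ⊢
        omega
    · exact absurd rfl h

theorem altM_zero (M : Multiset ℕ) (hM : ∀ x ∈ M, ∀ y ∈ M, x / 2 = y / 2 → x = y) (b : Bool)
    (m : ℕ) (hm : ∀ x ∈ M, x / 2 < m) (hc : m < M.card) : altM b M = 0 := by
  by_contra h
  have := alt_strict (M.sort (· ≤ ·)) (Multiset.pairwise_sort _ _)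
    (by simpa using hM) b m 0 (by simp) (by simpa using hm) h
  rcases this with h1 | h1
  · have := congrArg List.length h1
    simp at this
    simp [this] at hc
  · simp at h1
    omega


open Finset

variable {N : ℕ}

def ng (p : Fin N × Bool) : Fin N × Bool := (p.1, !p.2)

theorem ng_ng (p : Fin N × Bool) : ng (ng p) = p := by simp [ng]

/-- A finset of signed coordinates is a sign vector. -/
def Ok (X : Finset (Fin N × Bool)) : Prop := ∀ p ∈ X, ng p ∉ X

/-- Words describing maximal chains of sign vectors on the first `n` coordinates. -/
def V (n : ℕ) (w : Fin n → Fin N × Bool) : Prop :=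
  Function.Injective (fun k => (w k).1) ∧ ∀ k, ((w k).1 : ℕ) < n

def Xs {n : ℕ} (w : Fin n → Fin N × Bool) (j : Fin n) : Finset (Fin N × Bool) :=
  (univ.filter (· ≤ j)).image w

def Ms {n : ℕ} (lab : Finset (Fin N × Bool) → ℕ) (w : Fin n → Fin N × Bool) : Multiset ℕ :=
  (univ : Finset (Fin n)).val.map (fun j => lab (Xs w j))

def Fs {n : ℕ} (lab : Finset (Fin N × Bool) → ℕ) (w : Fin n → Fin N × Bool) (j : Fin n) :
    Multiset ℕ :=
  ((univ : Finset (Fin n)).erase j).val.map (fun j => lab (Xs w j))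

theorem Xs_nonempty {n : ℕ} (w : Fin n → Fin N × Bool) (j : Fin n) : (Xs w j).Nonempty :=
  ⟨w j, mem_image.2 ⟨j, by simp, rfl⟩⟩

theorem Xs_ok {n : ℕ} (w : Fin n → Fin N × Bool) (hw : V n w) (j : Fin n) : Ok (Xs w j) := by
  intro p hp hq
  obtain ⟨a, _, rfl⟩ := mem_image.1 hp
  obtain ⟨b, _, hb⟩ := mem_image.1 hq
  have : b = a := hw.1 (by simp [hb, ng])
  subst this
  have := congrArg Prod.snd hb
  simp [ng] at this

theorem Xs_mono {n : ℕ} (w : Fin n → Fin N × Bool) {i j : Fin n} (h : i ≤ j) :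
    Xs w i ⊆ Xs w j := by
  apply image_subset_image
  intro k hk
  simp at hk ⊢
  exact hk.trans h

theorem Xs_ng {n : ℕ} (w : Fin n → Fin N × Bool) (j : Fin n) :
    Xs (fun k => ng (w k)) j = (Xs w j).image ng := by
  simp only [Xs, image_image]; rfl

open Classical in
noncomputable def T (n : ℕ) (lab : Finset (Fin N × Bool) → ℕ) : ZMod 2 :=
  ∑ w : Fin n → Fin N × Bool with V n w, altM true (Ms lab w)

theorem Ms_compat {n : ℕ} (lab : Finset (Fin N × Bool) → ℕ)
    (hc : ∀ X Y, Ok Y → X.Nonempty → X ⊆ Y → lab X / 2 = lab Y / 2 → lab X = lab Y)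
    (w : Fin n → Fin N × Bool) (hw : V n w) :
    ∀ x ∈ Ms lab w, ∀ y ∈ Ms lab w, x / 2 = y / 2 → x = y := by
  intro x hx y hy hxy
  obtain ⟨i, _, rfl⟩ := Multiset.mem_map.1 hx
  obtain ⟨j, _, rfl⟩ := Multiset.mem_map.1 hy
  rcases le_total i j with h | h
  · exact hc _ _ (Xs_ok w hw j) (Xs_nonempty w i) (Xs_mono w h) hxy
  · exact (hc _ _ (Xs_ok w hw i) (Xs_nonempty w j) (Xs_mono w h) hxy.symm).symm

theorem V_ng {n : ℕ} (w : Fin n → Fin N × Bool) (hw : V n w) : V n (fun k => ng (w k)) :=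
  ⟨hw.1, hw.2⟩

theorem V_surj {n : ℕ} (hn : n + 1 ≤ N) (w : Fin (n + 1) → Fin N × Bool) (hw : V (n + 1) w) :
    ∃ k, (w k).1 = ⟨n, hn⟩ := by
  let g : Fin (n + 1) → Fin (n + 1) := fun k => ⟨(w k).1, hw.2 k⟩
  have hg : Function.Injective g := by
    intro a b hab
    apply hw.1
    have := congrArg Fin.val hab
    exact Fin.ext this
  obtain ⟨k, hk⟩ := (Finite.surjective_of_injective hg) (Fin.last n)
  refine ⟨k, Fin.ext ?_⟩
  have := congrArg Fin.val hk
  simpa [g] using this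

/-- Hemisphere condition. -/
def H {n : ℕ} (hn : n + 1 ≤ N) (w : Fin (n + 1) → Fin N × Bool) : Prop :=
  ∃ k, w k = (⟨n, hn⟩, true)

theorem H_ng {n : ℕ} (hn : n + 1 ≤ N) (w : Fin (n + 1) → Fin N × Bool) (hw : V (n + 1) w) :
    H hn (fun k => ng (w k)) ↔ ¬ H hn w := by
  constructor
  · rintro ⟨k, hk⟩ ⟨l, hl⟩
    have : k = l := hw.1 (by
      have := congrArg Prod.fst hk
      simp [ng] at this
      simp [hl, this])
    subst this
    simp [hl, ng] at hk
  · intro h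
    obtain ⟨k, hk⟩ := V_surj hn w hw
    refine ⟨k, ?_⟩
    have : (w k).2 = false := by
      by_contra h2
      apply h
      exact ⟨k, Prod.ext hk (by simpa using h2)⟩
    simp [ng, hk, this]

theorem Xs_swap {n : ℕ} (w : Fin (n + 1) → Fin N × Bool) (j : Fin n) (i : Fin (n + 1))
    (hi : i ≠ j.castSucc) :
    Xs (w ∘ Equiv.swap j.castSucc j.succ) i = Xs w i := by
  have key : ∀ k, k ≤ i → Equiv.swap j.castSucc j.succ k ≤ i := by
    intro k hk
    by_cases h1 : k = j.castSucc
    · subst h1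
      rw [Equiv.swap_apply_left]
      have : j.castSucc < i := lt_of_le_of_ne hk (Ne.symm hi)
      exact Fin.castSucc_lt_iff_succ_le.1 this
    · by_cases h2 : k = j.succ
      · subst h2
        rw [Equiv.swap_apply_right]
        exact (Fin.castSucc_lt_succ).le.trans hk
      · rwa [Equiv.swap_apply_of_ne_of_ne h1 h2]
  ext p
  simp only [Xs, mem_image, mem_filter, mem_univ, true_and, Function.comp]
  constructor
  · rintro ⟨k, hk, rfl⟩
    exact ⟨_, key k hk, rfl⟩
  · rintro ⟨k, hk, rfl⟩
    exact ⟨_, key k hk, by simp⟩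

theorem Fs_congr {n : ℕ} (lab : Finset (Fin N × Bool) → ℕ) (w w' : Fin n → Fin N × Bool)
    (j : Fin n) (h : ∀ i, i ≠ j → Xs w i = Xs w' i) : Fs lab w j = Fs lab w' j := by
  apply Multiset.map_congr rfl
  intro i hi
  rw [h i]
  have : i ∈ univ.erase j := hi
  exact (mem_erase.1 this).1

open Classical in
theorem sum_facet_inner {n : ℕ} (hn : n + 1 ≤ N) (lab : Finset (Fin N × Bool) → ℕ) (j : Fin n) :
    ∑ w : Fin (n + 1) → Fin N × Bool with (V (n + 1) w ∧ H hn w),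
      altM true (Fs lab w j.castSucc) = 0 := by
  have hne : j.castSucc ≠ j.succ := (Fin.castSucc_lt_succ).ne
  refine Finset.sum_involution (fun w _ => w ∘ Equiv.swap j.castSucc j.succ) ?_ ?_ ?_ ?_
  · intro w hw
    rw [Fs_congr lab _ w j.castSucc (fun i hi => Xs_swap w j i hi), z2]
  · intro w hw _ heq
    simp only [mem_filter, mem_univ, true_and] at hw
    have := congrFun heq j.castSucc
    simp only [Function.comp, Equiv.swap_apply_left] at this
    exact hne (hw.1.1 (by simp [this])).symm.symm
  · intro w hw
    simp only [mem_filter, mem_univ, true_and] at hw ⊢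
    obtain ⟨⟨h1, h2⟩, k, hk⟩ := hw
    refine ⟨⟨?_, fun k => h2 _⟩, Equiv.swap j.castSucc j.succ k, by simp [hk]⟩
    exact h1.comp (Equiv.injective _)
  · intro w hw
    ext k <;> simp

theorem Xs_update {n : ℕ} (w : Fin (n + 1) → Fin N × Bool) (p : Fin N × Bool) (i : Fin (n + 1))
    (hi : i ≠ Fin.last n) : Xs (Function.update w (Fin.last n) p) i = Xs w i := by
  apply image_congr
  intro k hk
  simp at hk
  rw [Function.update_of_ne]
  exact (lt_of_le_of_lt hk (Fin.lt_last_iff_ne_last.2 hi)).ne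

open Classical in
theorem sum_facet_last_zero {n : ℕ} (hn : n + 1 ≤ N) (lab : Finset (Fin N × Bool) → ℕ) :
    ∑ w : Fin (n + 1) → Fin N × Bool with
      ((V (n + 1) w ∧ H hn w) ∧ ¬ (w (Fin.last n) = (⟨n, hn⟩, true))),
      altM true (Fs lab w (Fin.last n)) = 0 := by
  refine Finset.sum_involution
    (fun w _ => Function.update w (Fin.last n) (ng (w (Fin.last n)))) ?_ ?_ ?_ ?_
  · intro w hw
    rw [Fs_congr lab _ w (Fin.last n) (fun i hi => Xs_update w _ i hi), z2]
  · intro w hw _ heq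
    have := congrFun heq (Fin.last n)
    simp only [Function.update_self] at this
    have := congrArg Prod.snd this
    simp [ng] at this
  · intro w hw
    simp only [mem_filter, mem_univ, true_and] at hw ⊢
    obtain ⟨⟨⟨h1, h2⟩, k, hk⟩, h3⟩ := hw
    have hkl : k ≠ Fin.last n := by
      rintro rfl; exact h3 hk
    have e : ∀ i, (Function.update w (Fin.last n) (ng (w (Fin.last n))) i).1 = (w i).1 := by
      intro i
      by_cases hi : i = Fin.last n
      · subst hi; simp [ng]
      · rw [Function.update_of_ne hi]
    refine ⟨⟨⟨?_, ?_⟩, k, ?_⟩, ?_⟩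
    · simpa only [e] using h1
    · simpa only [e] using h2
    · rw [Function.update_of_ne hkl, hk]
    · rw [Function.update_self]
      intro h4
      apply hkl
      apply h1
      have := congrArg Prod.fst h4
      simp [ng] at this
      simp [hk, this]
  · intro w hw
    simp [ng_ng]

theorem Xs_snoc {n : ℕ} (w : Fin n → Fin N × Bool) (p : Fin N × Bool) (i : Fin n) :
    Xs (Fin.snoc w p : Fin (n + 1) → Fin N × Bool) i.castSucc = Xs w i := by
  ext q
  simp only [Xs, mem_image, mem_filter, mem_univ, true_and]
  constructor
  · rintro ⟨k, hk, rfl⟩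
    have hk' : k ≠ Fin.last n := (lt_of_le_of_lt hk (Fin.castSucc_lt_last i)).ne
    obtain ⟨l, rfl⟩ := Fin.exists_castSucc_eq.2 hk'
    exact ⟨l, by simpa using hk, by simp⟩
  · rintro ⟨k, hk, rfl⟩
    exact ⟨k.castSucc, by simpa using hk, by simp⟩

theorem Fs_snoc {n : ℕ} (lab : Finset (Fin N × Bool) → ℕ) (w : Fin n → Fin N × Bool)
    (p : Fin N × Bool) :
    Fs lab (Fin.snoc w p : Fin (n + 1) → Fin N × Bool) (Fin.last n) = Ms lab w := by
  have : (univ : Finset (Fin (n + 1))).erase (Fin.last n) = univ.map Fin.castSuccEmb := by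
    ext k
    simp only [mem_erase, mem_univ, and_true, mem_map, true_and]
    exact (Fin.exists_castSucc_eq).symm
  unfold Fs Ms
  rw [this, Finset.map_val, Multiset.map_map]
  apply Multiset.map_congr rfl
  intro i _
  simp only [Function.comp]
  exact congrArg lab (Xs_snoc w p i)

open Classical in
theorem sum_facet_last {n : ℕ} (hn : n + 1 ≤ N) (lab : Finset (Fin N × Bool) → ℕ) :
    ∑ w : Fin (n + 1) → Fin N × Bool with
      ((V (n + 1) w ∧ H hn w) ∧ (w (Fin.last n) = (⟨n, hn⟩, true))),
      altM true (Fs lab w (Fin.last n)) = T n lab := by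
  unfold T
  symm
  refine Finset.sum_bij' (fun w _ => (Fin.snoc w (⟨n, hn⟩, true) : Fin (n + 1) → Fin N × Bool))
    (fun w _ => fun k => w k.castSucc) ?_ ?_ ?_ ?_ ?_
  · intro w hw
    simp only [mem_filter, mem_univ, true_and] at hw ⊢
    refine ⟨⟨⟨?_, ?_⟩, Fin.last n, by simp⟩, by simp⟩
    · intro a b
      refine Fin.lastCases ?_ (fun a => ?_) a <;> refine Fin.lastCases ?_ (fun b => ?_) b
      · simp
      · intro h
        simp at h
        have h2 := hw.2 b
        rw [← h] at h2
        simp at h2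
      · intro h
        simp at h
        have h2 := hw.2 a
        rw [h] at h2
        simp at h2
      · intro h
        simp at h
        rw [hw.1 h]
    · intro k
      refine Fin.lastCases ?_ (fun a => ?_) k
      · simp
      · simpa using (hw.2 a).trans (Nat.lt_succ_self n)
  · intro w hw
    simp only [mem_filter, mem_univ, true_and] at hw ⊢
    obtain ⟨⟨⟨h1, h2⟩, _⟩, h3⟩ := hw
    refine ⟨?_, ?_⟩
    · intro a b hab
      exact Fin.castSucc_injective n (h1 hab)
    · intro k
      have h4 := h2 k.castSucc
      have h5 : ((w k.castSucc).1 : ℕ) ≠ n := by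
        intro h6
        have : k.castSucc = Fin.last n := h1 (by
          simp only [h3]
          exact Fin.ext h6)
        exact (Fin.castSucc_lt_last k).ne this
      change ((w k.castSucc).1 : ℕ) < n
      omega
  · intro w hw
    simp
  · intro w hw
    simp only [mem_filter, mem_univ, true_and] at hw
    rw [← hw.2]
    exact Fin.snoc_init_self w
  · intro w hw
    rw [Fs_snoc]

theorem T_succ {n : ℕ} (hn : n + 1 ≤ N) (lab : Finset (Fin N × Bool) → ℕ)
    (hneg : ∀ X, Ok X → X.Nonempty → lab (X.image ng) = fl (lab X))
    (hc : ∀ X Y, Ok Y → X.Nonempty → X ⊆ Y → lab X / 2 = lab Y / 2 → lab X = lab Y) :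
    T (n + 1) lab = T n lab := by
  classical
  have e1 : T (n + 1) lab = ∑ w : Fin (n + 1) → Fin N × Bool with (V (n + 1) w ∧ H hn w),
      (altM true (Ms lab w) + altM false (Ms lab w)) := by
    unfold T
    rw [← Finset.sum_filter_add_sum_filter_not _ (fun w => H hn w), Finset.sum_add_distrib,
      Finset.filter_filter, Finset.filter_filter]
    congr 1
    refine Finset.sum_bij' (fun w _ => fun k => ng (w k)) (fun w _ => fun k => ng (w k))
      ?_ ?_ ?_ ?_ ?_
    · intro w hw
      simp only [mem_filter, mem_univ, true_and] at hw ⊢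
      exact ⟨V_ng w hw.1, (H_ng hn w hw.1).2 hw.2⟩
    · intro w hw
      simp only [mem_filter, mem_univ, true_and] at hw ⊢
      refine ⟨V_ng w hw.1, fun h => (H_ng hn w hw.1).1 h hw.2⟩
    · intro w hw
      simp [ng_ng]
    · intro w hw
      simp [ng_ng]
    · intro w hw
      simp only [mem_filter, mem_univ, true_and] at hw
      have : Ms lab (fun k => ng (w k)) = (Ms lab w).map fl := by
        unfold Ms
        rw [Multiset.map_map]
        apply Multiset.map_congr rfl
        intro j _
        simp only [Function.comp]
        rw [Xs_ng, hneg _ (Xs_ok w hw.1 j) (Xs_nonempty w j)]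
      rw [this, altM_fl _ (Ms_compat lab hc w hw.1)]
      rfl
  have e2 : ∀ w : Fin (n + 1) → Fin N × Bool,
      altM true (Ms lab w) + altM false (Ms lab w) = ∑ j, altM true (Fs lab w j) := by
    intro w
    have h := altM_sum (Ms lab w) (by
      intro h
      have := congrArg Multiset.card h
      simp [Ms] at this) true
    rw [Bool.not_true] at h
    rw [← h]
    unfold Finset.sum
    conv_lhs => rw [Ms, Multiset.map_map]
    congr 1
    apply Multiset.map_congr rfl
    intro j hj
    simp only [Function.comp, Fs, Finset.erase_val]
    rw [Multiset.map_erase_of_mem _ _ hj]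
  rw [e1, Finset.sum_congr rfl (fun w _ => e2 w), Finset.sum_comm, Fin.sum_univ_castSucc,
    Finset.sum_eq_zero (fun j _ => sum_facet_inner hn lab j), zero_add,
    ← Finset.sum_filter_add_sum_filter_not _ (fun w => w (Fin.last n) = (⟨n, hn⟩, true)),
    Finset.filter_filter, Finset.filter_filter, sum_facet_last, sum_facet_last_zero, add_zero]

/-- Octahedral Tucker lemma. -/
theorem tucker (hN : 0 < N) (lab : Finset (Fin N × Bool) → ℕ)
    (hneg : ∀ X, Ok X → X.Nonempty → lab (X.image ng) = fl (lab X))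
    (hc : ∀ X Y, Ok Y → X.Nonempty → X ⊆ Y → lab X / 2 = lab Y / 2 → lab X = lab Y)
    (hb : ∀ X, Ok X → X.Nonempty → lab X / 2 + 1 < N) : False := by
  classical
  have h1 : ∀ n, n ≤ N → T n lab = 1 := by
    intro n
    induction n with
    | zero =>
      intro _
      unfold T
      rw [Finset.filter_true_of_mem]
      · simp [Ms, altM, alt]
      · intro w _
        exact ⟨fun a => a.elim0, fun a => a.elim0⟩
    | succ n ih =>
      intro hn
      rw [T_succ hn lab hneg hc, ih (by omega)]
  have h2 : T N lab = 0 := by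
    unfold T
    apply Finset.sum_eq_zero
    intro w hw
    simp only [mem_filter, mem_univ, true_and] at hw
    apply altM_zero _ (Ms_compat lab hc w hw) _ (N - 1)
    · intro x hx
      obtain ⟨i, _, rfl⟩ := Multiset.mem_map.1 hx
      have := hb _ (Xs_ok w hw i) (Xs_nonempty w i)
      omega
    · simp [Ms]; omega
  rw [h1 N le_rfl] at h2
  exact absurd h2 (by decide)


/-- `X` has an alternating sequence of length `m`, starting with sign `b`, in positions `≥ lo`. -/
def R (X : Finset (Fin N × Bool)) : ℕ → Bool → ℕ → Prop
  | 0, _, _ => True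
  | m + 1, b, lo => ∃ x : Fin N, lo ≤ (x : ℕ) ∧ (x, b) ∈ X ∧ R X m (!b) (x + 1)

theorem R_mono {X Y : Finset (Fin N × Bool)} (h : X ⊆ Y) (m : ℕ) (b : Bool) (lo : ℕ)
    (hR : R X m b lo) : R Y m b lo := by
  induction m generalizing b lo with
  | zero => trivial
  | succ m ih =>
    obtain ⟨x, h1, h2, h3⟩ := hR
    exact ⟨x, h1, h h2, ih _ _ h3⟩

theorem R_le {X : Finset (Fin N × Bool)} (m : ℕ) (b : Bool) (lo : ℕ)
    (hR : R X m b lo) (hlo : lo ≤ N) : lo + m ≤ N := by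
  induction m generalizing b lo with
  | zero => simpa using hlo
  | succ m ih =>
    obtain ⟨x, h1, h2, h3⟩ := hR
    have := ih _ _ h3 x.2
    omega

theorem R_pred {X : Finset (Fin N × Bool)} (m : ℕ) (b : Bool) (lo : ℕ)
    (hR : R X (m + 1) b lo) : R X m b lo := by
  induction m generalizing b lo with
  | zero => trivial
  | succ m ih =>
    obtain ⟨x, h1, h2, h3⟩ := hR
    exact ⟨x, h1, h2, ih _ _ h3⟩

theorem R_anti {X : Finset (Fin N × Bool)} {m m' : ℕ} (h : m ≤ m') (b : Bool) (lo : ℕ)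
    (hR : R X m' b lo) : R X m b lo := by
  induction h with
  | refl => exact hR
  | step _ ih => exact ih (R_pred _ _ _ hR)

theorem mem_ng {X : Finset (Fin N × Bool)} (x : Fin N) (b : Bool) :
    (x, b) ∈ X.image ng ↔ (x, !b) ∈ X := by
  rw [mem_image]
  constructor
  · rintro ⟨p, hp, h⟩
    have : p = (x, !b) := by rw [← ng_ng p, h]; rfl
    rwa [← this]
  · intro h
    exact ⟨_, h, by simp [ng]⟩

theorem R_ng {X : Finset (Fin N × Bool)} (m : ℕ) (b : Bool) (lo : ℕ) :
    R (X.image ng) m b lo ↔ R X m (!b) lo := by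
  induction m generalizing b lo with
  | zero => exact Iff.rfl
  | succ m ih =>
    simp only [R, mem_ng, ih]

theorem R_both {X : Finset (Fin N × Bool)} (hX : Ok X) (m : ℕ) (hm : 0 < m)
    (h1 : R X m true 0) (h2 : R X m false 0) : ∃ b, R X (m + 1) b 0 := by
  obtain ⟨m, rfl⟩ : ∃ m', m = m' + 1 := ⟨m - 1, by omega⟩
  obtain ⟨x, _, hx, hx'⟩ := h1
  obtain ⟨y, _, hy, hy'⟩ := h2
  rcases lt_trichotomy x y with h | h | h
  · exact ⟨true, x, by simp, hx, y, h, hy, hy'⟩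
  · subst h
    exact absurd hy (hX _ hx)
  · exact ⟨false, y, by simp, hy, x, h, hx, hx'⟩

/-- The elements of sign `b`, translated by `a`. -/
def side (a : ℕ) (X : Finset (Fin N × Bool)) (b : Bool) : Finset ℕ :=
  (univ.filter (fun i : Fin N => (i, b) ∈ X)).image (fun i : Fin N => a + (i : ℕ))

theorem side_mono (a : ℕ) {X Y : Finset (Fin N × Bool)} (h : X ⊆ Y) (b : Bool) :
    side a X b ⊆ side a Y b := by
  apply image_subset_image
  intro i hi
  simp at hi ⊢
  exact h hi

theorem side_disj (a : ℕ) {Y : Finset (Fin N × Bool)} (hY : Ok Y) (b : Bool) :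
    Disjoint (side a Y b) (side a Y (!b)) := by
  rw [Finset.disjoint_left]
  intro x hx hy
  simp only [side, mem_image, mem_filter, mem_univ, true_and] at hx hy
  obtain ⟨i, hi, rfl⟩ := hx
  obtain ⟨j, hj, hij⟩ := hy
  have : j = i := Fin.ext (by omega)
  subst this
  exact hY _ hi hj

theorem side_ng (a : ℕ) (X : Finset (Fin N × Bool)) (b : Bool) :
    side a (X.image ng) b = side a X (!b) := by
  simp only [side, mem_ng]

theorem mem_side (a : ℕ) {X : Finset (Fin N × Bool)} {b : Bool} {x : Fin N} (h : (x, b) ∈ X) :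
    a + (x : ℕ) ∈ side a X b :=
  mem_image.2 ⟨x, by simpa using h, rfl⟩

theorem R_sets (a : ℕ) {X : Finset (Fin N × Bool)} (k : ℕ) (b : Bool) (lo : ℕ)
    (hR : R X (2 * k) b lo) : ∃ A B : Finset ℕ, A.card = k ∧ B.card = k ∧
      A ⊆ side a X b ∧ B ⊆ side a X (!b) ∧
      (∀ x ∈ A, a + lo ≤ x ∧ x + 1 < a + N) ∧ (∀ x ∈ B, a + lo + 1 ≤ x ∧ x < a + N) ∧
      (∀ x, ¬ (x ∈ A ∧ x + 1 ∈ A)) ∧ (∀ x, ¬ (x ∈ B ∧ x + 1 ∈ B)) := by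
  induction k generalizing b lo with
  | zero => exact ⟨∅, ∅, by simp⟩
  | succ k ih =>
    obtain ⟨x, hx1, hx2, y, hy1, hy2, h⟩ := hR
    rw [Bool.not_not] at h
    obtain ⟨A, B, hA, hB, hA1, hB1, hA2, hB2, hA3, hB3⟩ := ih b _ h
    have hy := y.2
    have nA : a + (x : ℕ) ∉ A := by
      intro h; have := hA2 _ h; omega
    have nB : a + (y : ℕ) ∉ B := by
      intro h; have := hB2 _ h; omega
    refine ⟨insert (a + (x : ℕ)) A, insert (a + (y : ℕ)) B, ?_, ?_, ?_, ?_, ?_, ?_, ?_, ?_⟩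
    · rw [card_insert_of_notMem nA, hA]
    · rw [card_insert_of_notMem nB, hB]
    · exact insert_subset (mem_side a hx2) hA1
    · exact insert_subset (mem_side a hy2) hB1
    · intro z hz
      rcases mem_insert.1 hz with rfl | hz
      · omega
      · have := hA2 _ hz; omega
    · intro z hz
      rcases mem_insert.1 hz with rfl | hz
      · omega
      · have := hB2 _ hz; omega
    · rintro z ⟨h1, h2⟩
      rcases mem_insert.1 h1 with h1 | h1 <;> rcases mem_insert.1 h2 with h2 | h2
      · omega
      · have := hA2 _ h2; omega
      · have := hA2 _ h1; omega
      · exact hA3 z ⟨h1, h2⟩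
    · rintro z ⟨h1, h2⟩
      rcases mem_insert.1 h1 with h1 | h1 <;> rcases mem_insert.1 h2 with h2 | h2
      · omega
      · have := hB2 _ h2; omega
      · have := hB2 _ h1; omega
      · exact hB3 z ⟨h1, h2⟩

theorem R_stable (a k : ℕ) (hk : 0 < k) {X : Finset (Fin N × Bool)} (b : Bool)
    (hR : R X (2 * k) b 0) (b' : Bool) :
    ∃ A, IsStableInInterval a (a + N - 1) k A ∧ A ⊆ side a X b' := by
  obtain ⟨A, B, hA, hB, hA1, hB1, hA2, hB2, hA3, hB3⟩ := R_sets a k b 0 hR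
  have sA : IsStableInInterval a (a + N - 1) k A := by
    refine ⟨?_, hA, hA3, ?_⟩
    · intro x hx
      have := hA2 x hx
      rw [mem_Icc]; omega
    · rintro ⟨h1, h2⟩
      have := hA2 _ h1
      omega
  have sB : IsStableInInterval a (a + N - 1) k B := by
    refine ⟨?_, hB, hB3, ?_⟩
    · intro x hx
      have := hB2 x hx
      rw [mem_Icc]; omega
    · rintro ⟨h1, h2⟩
      have := hB2 _ h2
      omega
  by_cases hb : b' = b
  · exact ⟨A, sA, by rwa [hb]⟩
  · have : b' = !b := by revert hb; cases b <;> cases b' <;> simp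
    exact ⟨B, sB, by rwa [this]⟩

/-- Smallest color on side `b`. -/
noncomputable def mc (a k : ℕ) (C : Finset ℕ → ℕ) (X : Finset (Fin N × Bool)) (b : Bool) : ℕ :=
  sInf {q | ∃ A, IsStableInInterval a (a + N - 1) k A ∧ A ⊆ side a X b ∧ C A = q}

theorem mc_ng (a k : ℕ) (C : Finset ℕ → ℕ) (X : Finset (Fin N × Bool)) (b : Bool) :
    mc a k C (X.image ng) b = mc a k C X (!b) := by
  simp only [mc, side_ng]

theorem mc_spec (a k : ℕ) (hk : 0 < k) (C : Finset ℕ → ℕ) {X : Finset (Fin N × Bool)}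
    (hX : ∃ b, R X (2 * k) b 0) (b : Bool) :
    ∃ A, IsStableInInterval a (a + N - 1) k A ∧ A ⊆ side a X b ∧ C A = mc a k C X b := by
  obtain ⟨b0, hb0⟩ := hX
  obtain ⟨A, h1, h2⟩ := R_stable a k hk b0 hb0 b
  exact Nat.sInf_mem (s := {q | ∃ A, IsStableInInterval a (a + N - 1) k A ∧
    A ⊆ side a X b ∧ C A = q}) ⟨_, A, h1, h2, rfl⟩

open Classical in
noncomputable def len (X : Finset (Fin N × Bool)) : ℕ :=
  Nat.findGreatest (fun m => ∃ b, R X m b 0) N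

theorem len_spec (X : Finset (Fin N × Bool)) : ∃ b, R X (len X) b 0 := by
  classical
  unfold len
  exact Nat.findGreatest_spec (P := fun m => ∃ b, R X m b 0) (Nat.zero_le N) ⟨true, trivial⟩

theorem le_len (X : Finset (Fin N × Bool)) (m : ℕ) (b : Bool) (h : R X m b 0) : m ≤ len X := by
  classical
  unfold len
  exact Nat.le_findGreatest (by simpa using R_le m b 0 h (Nat.zero_le _)) ⟨b, h⟩

theorem len_pos (X : Finset (Fin N × Bool)) (h : X.Nonempty) : 0 < len X := by
  obtain ⟨⟨x, b⟩, hx⟩ := h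
  exact le_len X 1 b ⟨x, by simp, hx, trivial⟩

theorem len_ng (X : Finset (Fin N × Bool)) : len (X.image ng) = len X := by
  apply le_antisymm
  · obtain ⟨b, hb⟩ := len_spec (X.image ng)
    exact le_len _ _ _ ((R_ng _ _ _).1 hb)
  · obtain ⟨b, hb⟩ := len_spec X
    exact le_len _ _ (!b) ((R_ng _ _ _).2 (by simpa using hb))

theorem len_sign (X : Finset (Fin N × Bool)) (hX : Ok X) (h : X.Nonempty) :
    R X (len X) false 0 ↔ ¬ R X (len X) true 0 := by
  constructor
  · intro h1 h2
    obtain ⟨b, hb⟩ := R_both hX _ (len_pos X h) h2 h1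
    have := le_len _ _ _ hb
    omega
  · intro h1
    obtain ⟨b, hb⟩ := len_spec X
    cases b
    · exact hb
    · exact absurd hb h1

theorem big_iff (X : Finset (Fin N × Bool)) (m : ℕ) : (∃ b, R X m b 0) ↔ m ≤ len X := by
  constructor
  · rintro ⟨b, hb⟩
    exact le_len _ _ _ hb
  · intro h
    obtain ⟨b, hb⟩ := len_spec X
    exact ⟨b, R_anti h _ _ hb⟩

theorem len_mono {X Y : Finset (Fin N × Bool)} (h : X ⊆ Y) : len X ≤ len Y := by
  obtain ⟨b, hb⟩ := len_spec X
  exact le_len _ _ _ (R_mono h _ _ _ hb)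

theorem Ok_subset {X Y : Finset (Fin N × Bool)} (h : X ⊆ Y) (hY : Ok Y) : Ok X :=
  fun p hp hq => hY p (h hp) (h hq)

open Classical in
noncomputable def lab (a k : ℕ) (C : Finset ℕ → ℕ) (X : Finset (Fin N × Bool)) : ℕ :=
  if 2 * k ≤ len X then
    2 * (2 * k - 1 + min (mc a k C X true) (mc a k C X false)) +
      (if mc a k C X true < mc a k C X false then 1 else 0)
  else 2 * (len X - 1) + (if R X (len X) true 0 then 1 else 0)

theorem fl_even (u : ℕ) : fl (2 * u) = 2 * u + 1 := by
  unfold fl; split_ifs <;> omega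

theorem fl_odd (u : ℕ) : fl (2 * u + 1) = 2 * u := by
  unfold fl; split_ifs <;> omega

/-- Schrijver's theorem (lower bound). -/
theorem schrijver (a k d N : ℕ) (hk : 0 < k) (hd : 2 ≤ d) (hN : N = 2 * k + d - 2)
    (C : Finset ℕ → ℕ)
    (hC : ∀ A, IsStableInInterval a (a + N - 1) k A → C A + 1 < d) :
    ∃ A B, IsStableInInterval a (a + N - 1) k A ∧ IsStableInInterval a (a + N - 1) k B ∧
      Disjoint A B ∧ C A = C B := by
  classical
  by_contra hcon
  have key : ∀ X X' Y : Finset (Fin N × Bool), Ok Y → X ⊆ Y → X' ⊆ Y → 2 * k ≤ len X →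
      2 * k ≤ len X' → ∀ b, mc a k C X b ≠ mc a k C X' (!b) := by
    intro X X' Y hY hX hX' h1 h2 b heq
    obtain ⟨A, sA, hA, cA⟩ := mc_spec a k hk C ((big_iff X _).2 h1) b
    obtain ⟨B, sB, hB, cB⟩ := mc_spec a k hk C ((big_iff X' _).2 h2) (!b)
    apply hcon
    refine ⟨A, B, sA, sB, ?_, by rw [cA, cB, heq]⟩
    exact (side_disj a hY b).mono (hA.trans (side_mono a hX b)) (hB.trans (side_mono a hX' _))
  refine tucker (N := N) (by omega) (lab a k C) ?_ ?_ ?_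
  · intro X hX hne
    unfold lab
    rw [len_ng, mc_ng, mc_ng]
    simp only [Bool.not_true, Bool.not_false]
    split_ifs with h1 h2 h3 h3 h2 h3 h3
    · omega
    · rw [add_zero, fl_even, min_comm]
    · rw [add_zero, fl_odd, min_comm]
    · have := key X X X hX subset_rfl subset_rfl h1 h1 true
      simp only [Bool.not_true] at this
      omega
    · rw [R_ng, Bool.not_true, len_sign X hX hne] at h2
      exact absurd h3 h2
    · rw [add_zero, fl_even]
    · rw [add_zero, fl_odd]
    · rw [R_ng, Bool.not_true, len_sign X hX hne] at h2
      exact absurd h3 h2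
  · intro X Y hY hne hXY
    have hX := Ok_subset hXY hY
    have hl := len_mono hXY
    have hp := len_pos X hne
    unfold lab
    by_cases h1 : 2 * k ≤ len X
    · have h2 : 2 * k ≤ len Y := h1.trans hl
      rw [if_pos h1, if_pos h2]
      have k1 := key X Y Y hY hXY subset_rfl h1 h2 true
      have k2 := key X Y Y hY hXY subset_rfl h1 h2 false
      simp only [Bool.not_true, Bool.not_false] at k1 k2
      split_ifs <;> omega
    · rw [if_neg h1]
      by_cases h2 : 2 * k ≤ len Y
      · rw [if_pos h2]
        split_ifs <;> omega
      · rw [if_neg h2]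
        intro h
        have he : len X = len Y := by
          revert h
          split_ifs <;> omega
        have hiff : R X (len X) true 0 ↔ R Y (len Y) true 0 := by
          constructor
          · intro h; rw [← he]; exact R_mono hXY _ _ _ h
          · intro h
            by_contra h3
            rw [← len_sign X hX hne] at h3
            have h4 := R_mono hXY _ _ _ h3
            rw [he] at h4
            exact (len_sign Y hY (hne.mono hXY)).1 h4 h
        simp only [he] at hiff ⊢
        simp only [hiff]
  · intro X hX hne
    have hp := len_pos X hne
    unfold lab
    by_cases h1 : 2 * k ≤ len X
    · rw [if_pos h1]
      have k1 := key X X X hX subset_rfl subset_rfl h1 h1 true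
      obtain ⟨A, sA, hA, cA⟩ := mc_spec a k hk C ((big_iff X _).2 h1) true
      obtain ⟨B, sB, hB, cB⟩ := mc_spec a k hk C ((big_iff X _).2 h1) false
      have := hC A sA
      have := hC B sB
      simp only [Bool.not_true] at k1
      split_ifs <;> omega
    · rw [if_neg h1]
      split_ifs <;> omega

end SchrijverAux

/-- For `d ≥ 2`, `n ≥ 2k`, `t = ⌊n/(2k+d-2)⌋`, `m = d·t − 1`: given pairwise disjoint
intervals `J_1, ..., J_t ⊆ [n]` of `2k+d-2` consecutive elements each, and any coloring
`c` with `m` colors, there are two disjoint sets `A, B`, each a stable `k`-subset of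
some `J_i` (with respect to `J_i`'s cyclic order), with `c(A) = c(B)`. -/
theorem stmt15 (d n k t : ℕ) (hd : 2 ≤ d) (hn : 2 * k ≤ n)
    (ht : t = n / (2 * k + d - 2))
    (a : Fin t → ℕ)
    (ha1 : ∀ i, 1 ≤ a i)
    (ha2 : ∀ i, a i + (2 * k + d - 2) - 1 ≤ n)
    (hdisj : ∀ i j, i ≠ j →
      Disjoint (Finset.Icc (a i) (a i + (2 * k + d - 2) - 1))
        (Finset.Icc (a j) (a j + (2 * k + d - 2) - 1)))
    (c : Finset ℕ → Fin (d * t - 1)) :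
    ∃ A B : Finset ℕ,
      (∃ i, IsStableInInterval (a i) (a i + (2 * k + d - 2) - 1) k A) ∧
      (∃ j, IsStableInInterval (a j) (a j + (2 * k + d - 2) - 1) k B) ∧
      Disjoint A B ∧ c A = c B := by
  classical
  have ht0 : 0 < t := by
    rcases Nat.eq_zero_or_pos t with h | h
    · subst h
      exact absurd (c ∅).2 (by simp)
    · exact h
  rcases Nat.eq_zero_or_pos k with hk | hk
  · subst hk
    have : IsStableInInterval (a ⟨0, ht0⟩) (a ⟨0, ht0⟩ + (2 * 0 + d - 2) - 1) 0 ∅ := by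
      simp [IsStableInInterval]
    exact ⟨∅, ∅, ⟨_, this⟩, ⟨_, this⟩, by simp, rfl⟩
  by_contra hcon
  let S : Fin t → Finset (Finset ℕ) := fun i =>
    (Finset.Icc (a i) (a i + (2 * k + d - 2) - 1)).powerset.filter
      (fun A => IsStableInInterval (a i) (a i + (2 * k + d - 2) - 1) k A)
  have hS : ∀ i A, A ∈ S i ↔ IsStableInInterval (a i) (a i + (2 * k + d - 2) - 1) k A := by
    intro i A
    simp only [S, Finset.mem_filter, Finset.mem_powerset]
    exact ⟨fun h => h.2, fun h => ⟨h.1, h⟩⟩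
  have hcard : ∀ i, d ≤ ((S i).image c).card := by
    intro i
    by_contra hlt
    let e := ((S i).image c).equivFin
    let C : Finset ℕ → ℕ := fun A =>
      if h : c A ∈ (S i).image c then (e ⟨c A, h⟩ : ℕ) else 0
    obtain ⟨A, B, sA, sB, hAB, hCAB⟩ := SchrijverAux.schrijver (a i) k d (2 * k + d - 2) hk hd rfl C (by
      intro A hA
      have h : c A ∈ (S i).image c := Finset.mem_image_of_mem _ ((hS i A).2 hA)
      simp only [C, dif_pos h]
      have := (e ⟨c A, h⟩).2
      omega)
    apply hcon
    refine ⟨A, B, ⟨i, sA⟩, ⟨i, sB⟩, hAB, ?_⟩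
    have hA : c A ∈ (S i).image c := Finset.mem_image_of_mem _ ((hS i A).2 sA)
    have hB : c B ∈ (S i).image c := Finset.mem_image_of_mem _ ((hS i B).2 sB)
    simp only [C, dif_pos hA, dif_pos hB] at hCAB
    have := e.injective (Fin.ext hCAB)
    exact congrArg Subtype.val this
  have hdis : ∀ i ∈ (Finset.univ : Finset (Fin t)), ∀ j ∈ (Finset.univ : Finset (Fin t)), i ≠ j →
      Disjoint ((S i).image c) ((S j).image c) := by
    intro i _ j _ hij
    rw [Finset.disjoint_left]
    intro x hx hy
    obtain ⟨A, hA, rfl⟩ := Finset.mem_image.1 hx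
    obtain ⟨B, hB, hAB⟩ := Finset.mem_image.1 hy
    rw [hS] at hA hB
    exact hcon ⟨A, B, ⟨i, hA⟩, ⟨j, hB⟩, (hdisj i j hij).mono hA.1 hB.1, hAB.symm⟩
  have h1 := Finset.card_biUnion hdis
  have h2 : (Finset.univ.biUnion (fun i => (S i).image c)).card ≤ d * t - 1 := by
    simpa using Finset.card_le_univ (Finset.univ.biUnion (fun i => (S i).image c))
  have h3 : t * d ≤ ∑ i, ((S i).image c).card := by
    simpa using Finset.card_nsmul_le_sum Finset.univ (fun i => ((S i).image c).card) d
      (fun i _ => hcard i)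
  have h4 : 0 < d * t := Nat.mul_pos (by omega) ht0
  rw [h1] at h2
  rw [mul_comm] at h3
  omega
end
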